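/- arXiv:2411.09482 — 3 statements merged into one kernel-verified Lean document; each statement's English description precedes it below -/
import Mathlib

section
/- Let d ≥ 2 be an integer, s ∈ (0, d/2), α ∈ (0,1) with s + α > 1. For n ∈ ℝ^d \ {0} define I_tra(n) := ∫_{ℝ^d} ⟨n−k⟩^{−d−2α} (|k|^{−2s} − |n|^{−2s}) |P⊥_{n−k} k|² dk, and set c_tra := −(d−1)(s+α−1)(d+2−2s−2α)·C_{d,s,α}. Then there exist constants R ≥ 1 and ρ ≥ 0 such that for every n with |n| ≥ R, |I_tra(n) − c_tra |n|^{−2s+2−2α}| ≤ ρ |n|^{−2s}. -/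
open MeasureTheory
open scoped RealInnerProductSpace

noncomputable section

/-- The Japanese bracket `⟨x⟩ = (1+|x|²)^{1/2}`. -/
def jap {d : ℕ} (x : EuclideanSpace ℝ (Fin d)) : ℝ := Real.sqrt (1 + ‖x‖^2)

/-- The orthogonal projection `P⊥_k x = x − (k·x/|k|²) k` (junk value: identity at `k = 0`). -/
def Pperp {d : ℕ} (k x : EuclideanSpace ℝ (Fin d)) : EuclideanSpace ℝ (Fin d) :=
  x - (⟪k, x⟫ / ‖k‖^2) • k

/-- The constant `C_{d,s,α}`. -/
def Cconst (d : ℕ) (s α : ℝ) : ℝ :=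
  -(Real.pi ^ ((d : ℝ)/2) * Real.Gamma (s + α - 1) * Real.Gamma (((d : ℝ) - 2*s + 2)/2)
      * Real.Gamma (-α)) /
    (4 * Real.Gamma s * Real.Gamma (((d : ℝ) + 2 + 2*α)/2)
      * Real.Gamma (((d : ℝ) + 4 - 2*s - 2*α)/2))


open Set

/-- The Gram determinant `|m|²|n|² − ⟨m,n⟩²` of two vectors. -/
def gramDet {d : ℕ} (n m : EuclideanSpace ℝ (Fin d)) : ℝ := ‖m‖^2 * ‖n‖^2 - ⟪m, n⟫^2

lemma gramDet_nonneg {d : ℕ} (n m : EuclideanSpace ℝ (Fin d)) : 0 ≤ gramDet n m := by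
  have h := abs_real_inner_le_norm m n
  have h2 := pow_le_pow_left₀ (abs_nonneg _) h 2
  rw [sq_abs, mul_pow] at h2
  unfold gramDet; linarith

lemma gramDet_add_smul {d : ℕ} (n m : EuclideanSpace ℝ (Fin d)) (c : ℝ) :
    gramDet n (m + c • n) = gramDet n m := by
  simp only [gramDet, norm_add_sq_real, inner_add_left, real_inner_smul_left,
    real_inner_smul_right, norm_smul, real_inner_self_eq_norm_sq, mul_pow, Real.norm_eq_abs, sq_abs]
  ring

@[fun_prop]
lemma continuous_gramDet {d : ℕ} (n : EuclideanSpace ℝ (Fin d)) : Continuous (gramDet n) := by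
  unfold gramDet; fun_prop

lemma normSq_Pperp_sub {d : ℕ} (n m : EuclideanSpace ℝ (Fin d)) (hm : m ≠ 0) :
    ‖Pperp m (n - m)‖^2 = gramDet n m / ‖m‖^2 := by
  have h0 : ‖m‖ ≠ 0 := norm_ne_zero_iff.2 hm
  have h1 : Pperp m (n - m) = n - (⟪m, n⟫ / ‖m‖^2) • m := by
    unfold Pperp
    rw [inner_sub_right, real_inner_self_eq_norm_sq, sub_div, div_self (pow_ne_zero 2 h0), sub_smul,
      one_smul]
    abel
  rw [h1, norm_sub_sq_real, real_inner_smul_right, norm_smul, mul_pow, Real.norm_eq_abs, sq_abs,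
    real_inner_comm m n, gramDet]
  field_simp
  ring

lemma integral_mul_self_mul_exp_neg_mul_sq {p : ℝ} (hp : 0 < p) :
    ∫ x : ℝ, x * x * Real.exp (-p * x^2) = (1 / (2*p)) * √(Real.pi / p) := by
  have h1 : ∀ x : ℝ, x * x * Real.exp (-p * x^2)
      = (fun y : ℝ => y ^ (2:ℝ) * Real.exp (-p * y ^ (2:ℝ))) |x| := by
    intro x
    simp only [Real.rpow_two, sq_abs]
    ring
  simp_rw [h1]
  rw [integral_comp_abs (f := fun y : ℝ => y ^ (2:ℝ) * Real.exp (-p * y ^ (2:ℝ))),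
    integral_rpow_mul_exp_neg_mul_rpow (by norm_num) (by norm_num) hp]
  have h2 : ((2:ℝ) + 1) / 2 = 1/2 + 1 := by norm_num
  rw [neg_div, h2, Real.Gamma_add_one (by norm_num), Real.Gamma_one_half_eq, Real.rpow_neg hp.le,
    Real.rpow_add hp, Real.rpow_one, ← Real.sqrt_eq_rpow, Real.sqrt_div Real.pi_pos.le]
  have := Real.sqrt_pos.2 hp
  field_simp

lemma integral_mul_exp_neg_mul_sq_eq_zero (p : ℝ) :
    ∫ x : ℝ, x * Real.exp (-p * x^2) = 0 := by
  have h := integral_neg_eq_self (fun x : ℝ => x * Real.exp (-p * x^2)) volume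
  simp only [neg_sq, neg_mul, integral_neg] at h
  simp only [neg_mul]
  linarith

lemma integrable_coord_mul_coord_mul_exp {d : ℕ} {p : ℝ} (hp : 0 < p) (i j : Fin d) :
    Integrable (fun m : EuclideanSpace ℝ (Fin d) => m i * m j * Real.exp (-p * ‖m‖^2)) ∧
    ∫ m : EuclideanSpace ℝ (Fin d), m i * m j * Real.exp (-p * ‖m‖^2) =
      if i = j then (1 / (2*p)) * √(Real.pi / p) ^ d else 0 := by
  set F : Fin d → ℝ → ℝ := fun k x =>
    (if i = k then x else 1) * (if j = k then x else 1) * Real.exp (-p * x^2) with hF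
  have hFint : ∀ k, Integrable (F k) := by
    intro k
    simp only [hF]
    split_ifs
    · have := integrable_rpow_mul_exp_neg_mul_sq hp (s := 2) (by norm_num)
      simpa [Real.rpow_two, sq] using this
    · simpa using integrable_mul_exp_neg_mul_sq hp
    · simpa using integrable_mul_exp_neg_mul_sq hp
    · simpa using integrable_exp_neg_mul_sq hp
  have hprod : ∀ m : EuclideanSpace ℝ (Fin d),
      m i * m j * Real.exp (-p * ‖m‖^2) = ∏ k, F k (m k) := by
    intro m
    simp only [hF, Finset.prod_mul_distrib, Finset.prod_ite_eq, Finset.mem_univ, if_true]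
    rw [← Real.exp_sum, EuclideanSpace.norm_sq_eq, Finset.mul_sum]
    simp
  have hmp := EuclideanSpace.volume_preserving_symm_measurableEquiv_toLp (Fin d)
  constructor
  · have h := hmp.integrable_comp_of_integrable (Integrable.fintype_prod hFint)
    refine h.congr (Filter.Eventually.of_forall fun m => ?_)
    exact (hprod m).symm
  · have h := hmp.integral_comp (MeasurableEquiv.measurableEmbedding _) (fun x => ∏ k, F k (x k))
    have h' : ∫ m : EuclideanSpace ℝ (Fin d), ∏ k, F k (m k) = ∏ k, ∫ x, F k x := by
      rw [← integral_fintype_prod_volume_eq_prod]; exact h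
    simp_rw [hprod]
    rw [h']
    split_ifs with hij
    · subst hij
      have : ∀ k, ∫ x, F k x = (if i = k then 1 / (2*p) else 1) * √(Real.pi / p) := by
        intro k
        simp only [hF]
        split_ifs
        · exact integral_mul_self_mul_exp_neg_mul_sq hp
        · simpa using integral_gaussian p
      rw [Finset.prod_congr rfl fun k _ => this k, Finset.prod_mul_distrib, Finset.prod_ite_eq]
      simp
    · apply Finset.prod_eq_zero (Finset.mem_univ i)
      simp only [hF, if_true, if_neg (Ne.symm hij), mul_one]
      exact integral_mul_exp_neg_mul_sq_eq_zero p

lemma gramDet_eq_sum {d : ℕ} (n m : EuclideanSpace ℝ (Fin d)) :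
    gramDet n m = ∑ i, ∑ j, ((if i = j then ‖n‖^2 else 0) - n i * n j) * (m i * m j) := by
  have h1 : ⟪m, n⟫ = ∑ i, n i * m i := by
    simp [PiLp.inner_apply]
  simp only [sub_mul, Finset.sum_sub_distrib, ite_mul, zero_mul, Finset.sum_ite_eq,
    Finset.mem_univ, if_true]
  rw [gramDet, h1, sq (∑ i, n i * m i), Finset.sum_mul_sum, EuclideanSpace.norm_sq_eq m,
    Finset.sum_mul]
  congr 1
  · exact Finset.sum_congr rfl fun i _ => by rw [Real.norm_eq_abs, sq_abs]; ring
  · exact Finset.sum_congr rfl fun i _ => Finset.sum_congr rfl fun j _ => by ring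

lemma integral_gramDet_mul_exp {d : ℕ} {p : ℝ} (hp : 0 < p) (n : EuclideanSpace ℝ (Fin d)) :
    Integrable (fun m : EuclideanSpace ℝ (Fin d) => gramDet n m * Real.exp (-p * ‖m‖^2)) ∧
    ∫ m : EuclideanSpace ℝ (Fin d), gramDet n m * Real.exp (-p * ‖m‖^2) =
      ((d:ℝ) - 1) / 2 * Real.pi ^ ((d:ℝ)/2) * ‖n‖^2 * p ^ (-(d:ℝ)/2 - 1) := by
  have hexp : ∀ m : EuclideanSpace ℝ (Fin d), gramDet n m * Real.exp (-p * ‖m‖^2) =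
      ∑ i, ∑ j, ((if i = j then ‖n‖^2 else 0) - n i * n j) *
        (m i * m j * Real.exp (-p * ‖m‖^2)) := by
    intro m
    rw [gramDet_eq_sum, Finset.sum_mul]
    refine Finset.sum_congr rfl fun i _ => ?_
    rw [Finset.sum_mul]
    exact Finset.sum_congr rfl fun j _ => by ring
  simp_rw [hexp]
  have hI := fun i j : Fin d => ((integrable_coord_mul_coord_mul_exp hp i j).1.const_mul
    ((if i = j then ‖n‖^2 else 0) - n i * n j))
  refine ⟨integrable_finsetSum _ fun i _ => integrable_finsetSum _ fun j _ => hI i j, ?_⟩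
  rw [integral_finsetSum _ fun i _ => integrable_finsetSum _ fun j _ => hI i j]
  simp_rw [integral_finsetSum _ fun j _ => hI _ j, integral_const_mul,
    (integrable_coord_mul_coord_mul_exp hp _ _).2]
  simp only [mul_ite, mul_zero, Finset.sum_ite_eq, Finset.mem_univ, if_true]
  rw [← Finset.sum_mul, Finset.sum_sub_distrib]
  have h1 : ∑ i, n i * n i = ‖n‖^2 := by
    rw [EuclideanSpace.norm_sq_eq]
    exact Finset.sum_congr rfl fun i _ => by rw [Real.norm_eq_abs, sq_abs]; ring
  have h2 : √(Real.pi / p) ^ d = Real.pi ^ ((d:ℝ)/2) * p ^ (-(d:ℝ)/2) := by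
    rw [Real.sqrt_eq_rpow, ← Real.rpow_natCast, ← Real.rpow_mul (by positivity),
      Real.div_rpow Real.pi_pos.le hp.le, neg_div, Real.rpow_neg hp.le, one_div_mul_eq_div]
    rfl
  rw [h1, h2, Real.rpow_sub_one hp.ne']
  simp
  field_simp

/-- Gaussian integral of the Gram determinant against two Gaussians centred at `0` and `n`. -/
lemma lintegral_gramDet_mul_exp_mul_exp {d : ℕ} {u t : ℝ} (hu : 0 < u) (ht : 0 ≤ t)
    (n : EuclideanSpace ℝ (Fin d)) :
    ∫⁻ m : EuclideanSpace ℝ (Fin d),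
      ENNReal.ofReal (gramDet n m * (Real.exp (-u * ‖m‖^2) * Real.exp (-t * ‖n - m‖^2))) =
      ENNReal.ofReal (((d:ℝ) - 1) / 2 * Real.pi ^ ((d:ℝ)/2) * ‖n‖^2 *
        ((t + u) ^ (-(d:ℝ)/2 - 1) * Real.exp (-(t * u / (t + u)) * ‖n‖^2))) := by
  have hp : 0 < t + u := by linarith
  rw [← lintegral_add_right_eq_self _ ((t / (t + u)) • n)]
  have h := integral_gramDet_mul_exp hp n
  have key : ∀ m : EuclideanSpace ℝ (Fin d), gramDet n (m + (t / (t + u)) • n) *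
      (Real.exp (-u * ‖m + (t / (t + u)) • n‖^2) *
        Real.exp (-t * ‖n - (m + (t / (t + u)) • n)‖^2)) =
      (gramDet n m * Real.exp (-(t+u) * ‖m‖^2)) * Real.exp (-(t * u / (t + u)) * ‖n‖^2) := by
    intro m
    have h3 : n - (m + (t / (t + u)) • n) = (u / (t+u)) • n - m := by
      have : u / (t + u) = 1 - t / (t + u) := by field_simp; ring
      rw [this, sub_smul, one_smul]; abel
    rw [gramDet_add_smul, mul_assoc, ← Real.exp_add, ← Real.exp_add, h3]
    congr 2
    rw [norm_add_sq_real, norm_sub_sq_real, real_inner_smul_left, real_inner_smul_right,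
      norm_smul, norm_smul, mul_pow, mul_pow, Real.norm_eq_abs, Real.norm_eq_abs, sq_abs, sq_abs,
      real_inner_comm]
    field_simp
    ring
  simp_rw [key]
  rw [← ofReal_integral_eq_lintegral_ofReal (h.1.mul_const _) (Filter.Eventually.of_forall fun m =>
    mul_nonneg (mul_nonneg (gramDet_nonneg _ _) (Real.exp_pos _).le) (Real.exp_pos _).le),
    integral_mul_const, h.2]
  congr 1
  ring

lemma integrableOn_rpow_mul_exp_neg_mul {r x : ℝ} (hr : 0 < r) (hx : 0 < x) :
    IntegrableOn (fun t : ℝ => t ^ (r - 1) * Real.exp (-(x * t))) (Ioi 0) := by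
  have h := integrableOn_rpow_mul_exp_neg_mul_rpow (p := 1) (s := r - 1) (b := x) (by linarith)
    one_pos hx
  simpa [neg_mul] using h

lemma integral_rpow_mul_exp_neg_mul {r x : ℝ} (hr : 0 < r) (hx : 0 < x) :
    ∫ t in Ioi (0:ℝ), t ^ (r - 1) * Real.exp (-(x * t)) = x ^ (-r) * Real.Gamma r := by
  rw [Real.integral_rpow_mul_exp_neg_mul_Ioi hr hx, one_div, Real.inv_rpow hx.le,
    Real.rpow_neg hx.le]

lemma lintegral_rpow_mul_exp_neg_mul {r x : ℝ} (hr : 0 < r) (hx : 0 < x) :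
    ∫⁻ t in Ioi (0:ℝ), ENNReal.ofReal (t ^ (r - 1) * Real.exp (-(x * t))) =
      ENNReal.ofReal (x ^ (-r) * Real.Gamma r) := by
  rw [← integral_rpow_mul_exp_neg_mul hr hx,
    ofReal_integral_eq_lintegral_ofReal (integrableOn_rpow_mul_exp_neg_mul hr hx)]
  filter_upwards [ae_restrict_mem measurableSet_Ioi] with t ht
  have : (0:ℝ) < t := ht
  simp only [Pi.zero_apply]; positivity

/-- The truncated power `θ ↦ (1 − θ)₊ ^ γ`. -/
def truncPow (γ θ : ℝ) : ℝ := (max (1 - θ) 0) ^ γ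

@[fun_prop]
lemma measurable_truncPow (γ : ℝ) : Measurable (truncPow γ) := by
  unfold truncPow; fun_prop

lemma truncPow_nonneg (γ θ : ℝ) : 0 ≤ truncPow γ θ := by unfold truncPow; positivity

lemma truncPow_le_one {γ θ : ℝ} (hγ : 0 < γ) (hθ : 0 ≤ θ) : truncPow γ θ ≤ 1 :=
  Real.rpow_le_one (le_max_right _ _) (by simp [hθ]) hγ.le

lemma truncPow_of_le {γ θ : ℝ} (hθ : θ ≤ 1) : truncPow γ θ = (1 - θ) ^ γ := by
  rw [truncPow, max_eq_left (by linarith)]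

lemma truncPow_of_ge {γ θ : ℝ} (hγ : 0 < γ) (hθ : 1 ≤ θ) : truncPow γ θ = 0 := by
  rw [truncPow, max_eq_right (by linarith), Real.zero_rpow hγ.ne']

lemma one_sub_truncPow_le {γ θ : ℝ} (hγ : 0 < γ) (hθ : 0 ≤ θ) :
    1 - truncPow γ θ ≤ (γ + 1) * θ := by
  rcases le_total 1 θ with h | h
  · rw [truncPow_of_ge hγ h]; nlinarith
  · rw [truncPow_of_le h]
    rcases le_total 1 γ with h1 | h1
    · have := one_add_mul_self_le_rpow_one_add (s := -θ) (by linarith) h1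
      rw [← sub_eq_add_neg 1 θ] at this
      linarith
    · have := Real.rpow_le_rpow_of_exponent_ge' (x := 1 - θ) (by linarith) (by linarith) hγ.le h1
      rw [Real.rpow_one] at this
      nlinarith

/-- The Laplace transform of `θ^(s-1) (1-θ)₊^γ`. -/
def laplaceTrunc (s γ x : ℝ) : ℝ :=
  ∫ θ in Ioi (0:ℝ), θ ^ (s - 1) * truncPow γ θ * Real.exp (-(x * θ))

/-- The defect `Γ(s) − x^s ∫ θ^(s-1) (1-θ)₊^γ e^(-xθ) dθ`, written as an integral. -/
def laplaceDefect (s γ x : ℝ) : ℝ :=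
  x ^ s * ∫ θ in Ioi (0:ℝ), θ ^ (s - 1) * (1 - truncPow γ θ) * Real.exp (-(x * θ))

lemma measurable_laplaceDefect (s γ : ℝ) : Measurable (laplaceDefect s γ) := by
  unfold laplaceDefect
  refine Measurable.mul (by fun_prop) ?_
  refine (StronglyMeasurable.integral_prod_right (f := fun x θ : ℝ =>
    θ ^ (s - 1) * (1 - truncPow γ θ) * Real.exp (-(x * θ))) ?_).measurable
  exact Measurable.stronglyMeasurable (by unfold Function.uncurry; fun_prop)

section
variable {s γ x : ℝ}

lemma integrableOn_laplaceTrunc (hs : 0 < s) (hγ : 0 < γ) (hx : 0 < x) :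
    IntegrableOn (fun θ : ℝ => θ ^ (s - 1) * truncPow γ θ * Real.exp (-(x * θ))) (Ioi 0) := by
  refine Integrable.mono' (integrableOn_rpow_mul_exp_neg_mul hs hx)
    (Measurable.aestronglyMeasurable (by fun_prop)) ?_
  filter_upwards [ae_restrict_mem measurableSet_Ioi] with t ht
  have ht : (0:ℝ) < t := ht
  have h1 := truncPow_nonneg γ t
  have h2 := truncPow_le_one hγ ht.le
  rw [Real.norm_of_nonneg (by positivity)]
  gcongr
  exact mul_le_of_le_one_right (by positivity) h2

lemma integrableOn_laplaceDefect (hs : 0 < s) (hγ : 0 < γ) (hx : 0 < x) :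
    IntegrableOn (fun θ : ℝ => θ ^ (s - 1) * (1 - truncPow γ θ) * Real.exp (-(x * θ)))
      (Ioi 0) := by
  refine ((integrableOn_rpow_mul_exp_neg_mul hs hx).sub
    (integrableOn_laplaceTrunc hs hγ hx)).congr (Filter.Eventually.of_forall fun t => ?_)
  simp only [Pi.sub_apply]; ring

lemma laplaceDefect_add (hs : 0 < s) (hγ : 0 < γ) (hx : 0 < x) :
    laplaceDefect s γ x + x ^ s * laplaceTrunc s γ x = Real.Gamma s := by
  rw [laplaceDefect, laplaceTrunc, ← mul_add,
    ← integral_add (integrableOn_laplaceDefect hs hγ hx) (integrableOn_laplaceTrunc hs hγ hx)]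
  have : ∀ θ : ℝ, θ ^ (s - 1) * (1 - truncPow γ θ) * Real.exp (-(x * θ)) +
      θ ^ (s - 1) * truncPow γ θ * Real.exp (-(x * θ)) = θ ^ (s - 1) * Real.exp (-(x * θ)) :=
    fun θ => by ring
  simp_rw [this]
  rw [integral_rpow_mul_exp_neg_mul hs hx, ← mul_assoc, ← Real.rpow_add hx]
  simp

lemma laplaceTrunc_nonneg (s γ x : ℝ) : 0 ≤ laplaceTrunc s γ x := by
  refine setIntegral_nonneg measurableSet_Ioi fun t ht => ?_
  have ht : (0:ℝ) < t := ht
  have h1 := truncPow_nonneg γ t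
  positivity

lemma laplaceDefect_nonneg (hγ : 0 < γ) (hx : 0 < x) : 0 ≤ laplaceDefect s γ x := by
  refine mul_nonneg (by positivity) (setIntegral_nonneg measurableSet_Ioi fun t ht => ?_)
  have ht : (0:ℝ) < t := ht
  have h1 := sub_nonneg.2 (truncPow_le_one hγ ht.le)
  positivity

lemma laplaceDefect_le (hs : 0 < s) (hγ : 0 < γ) (hx : 0 < x) :
    laplaceDefect s γ x ≤ (γ + 1) * Real.Gamma (s + 1) / x := by
  have h1 : ∫ θ in Ioi (0:ℝ), θ ^ (s - 1) * (1 - truncPow γ θ) * Real.exp (-(x * θ)) ≤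
      ∫ θ in Ioi (0:ℝ), (γ + 1) * (θ ^ (s + 1 - 1) * Real.exp (-(x * θ))) := by
    refine setIntegral_mono_on (integrableOn_laplaceDefect hs hγ hx)
      ((integrableOn_rpow_mul_exp_neg_mul (by linarith) hx).const_mul _) measurableSet_Ioi
      fun t ht => ?_
    have ht : (0:ℝ) < t := ht
    have h2 := one_sub_truncPow_le hγ ht.le
    have h3 : t ^ (s + 1 - 1) = t ^ (s - 1) * t := by
      rw [← Real.rpow_add_one ht.ne']; congr 1; ring
    rw [h3]
    calc _ ≤ t ^ (s - 1) * ((γ + 1) * t) * Real.exp (-(x * t)) := by gcongr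
      _ = _ := by ring
  rw [integral_const_mul, integral_rpow_mul_exp_neg_mul (by linarith) hx] at h1
  calc laplaceDefect s γ x ≤ x ^ s * ((γ + 1) * (x ^ (-(s + 1)) * Real.Gamma (s + 1))) := by
        unfold laplaceDefect; gcongr
    _ = (γ + 1) * Real.Gamma (s + 1) * (x ^ s * x ^ (-(s + 1))) := by ring
    _ = _ := by
      rw [← Real.rpow_add hx, show s + -(s + 1) = (-1:ℝ) by ring, Real.rpow_neg_one]
      rfl

end

lemma lintegral_beta {p q : ℝ} (hp : 0 < p) (hq : 0 < q) :
    ∫⁻ y in Ioo (0:ℝ) 1, ENNReal.ofReal (y ^ (p - 1) * (1 - y) ^ (q - 1)) =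
      ENNReal.ofReal (Real.Gamma p * Real.Gamma q / Real.Gamma (p + q)) := by
  have h := ProbabilityTheory.lintegral_betaPDF_eq_one hp hq
  have hB := ProbabilityTheory.beta_pos hp hq
  have h2 : ∀ y : ℝ, ProbabilityTheory.betaPDF p q y = (Ioo (0:ℝ) 1).indicator
      (fun y => ENNReal.ofReal (1 / ProbabilityTheory.beta p q) *
        ENNReal.ofReal (y ^ (p - 1) * (1 - y) ^ (q - 1))) y := by
    intro y
    rw [ProbabilityTheory.betaPDF_eq]
    by_cases hy : 0 < y ∧ y < 1
    · rw [if_pos hy, indicator_of_mem (by exact hy), ← ENNReal.ofReal_mul (by positivity)]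
      congr 1; ring
    · rw [if_neg hy, indicator_of_notMem (by exact hy)]; simp
  simp_rw [h2] at h
  rw [lintegral_indicator measurableSet_Ioo, lintegral_const_mul _ (by fun_prop)] at h
  have h3 : ENNReal.ofReal (ProbabilityTheory.beta p q) *
      ENNReal.ofReal (1 / ProbabilityTheory.beta p q) = 1 := by
    rw [← ENNReal.ofReal_mul hB.le, mul_one_div_cancel hB.ne', ENNReal.ofReal_one]
  change _ = ENNReal.ofReal (ProbabilityTheory.beta p q)
  rw [← mul_one (ENNReal.ofReal (ProbabilityTheory.beta p q)), ← h, ← mul_assoc, h3, one_mul]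

lemma one_sub_truncPow_eq_lintegral {γ θ : ℝ} (hγ : 0 < γ) (hθ : 0 < θ) :
    ENNReal.ofReal (1 - truncPow γ θ) =
      ∫⁻ y in Ioo (0:ℝ) 1, (Ioi y).indicator (fun _ => ENNReal.ofReal (γ * (1 - y) ^ (γ - 1))) θ := by
  have hm : 0 ≤ min θ 1 := by positivity
  have h1 : ∫ y in (0:ℝ)..(min θ 1), γ * (1 - y) ^ (γ - 1) = 1 - truncPow γ θ := by
    rw [intervalIntegral.integral_const_mul,
      intervalIntegral.integral_comp_sub_left (fun y => y ^ (γ - 1)) 1,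
      integral_rpow (Or.inl (by linarith))]
    have : 1 - min θ 1 = max (1 - θ) 0 := by
      rcases le_total θ 1 with h | h
      · rw [min_eq_left h, max_eq_left (by linarith)]
      · rw [min_eq_right h, max_eq_right (by linarith), sub_self]
    rw [this, truncPow]
    simp only [sub_zero, sub_add_cancel, Real.one_rpow]
    field_simp
  have h2 : IntervalIntegrable (fun y : ℝ => γ * (1 - y) ^ (γ - 1)) volume 0 (min θ 1) := by
    refine IntervalIntegrable.const_mul ?_ _
    have := (intervalIntegral.intervalIntegrable_rpow' (a := 1 - 0) (b := 1 - min θ 1)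
      (r := γ - 1) (by linarith)).comp_sub_left 1
    simpa using this
  rw [← h1, intervalIntegral.integral_of_le hm, integral_Ioc_eq_integral_Ioo,
    ofReal_integral_eq_lintegral_ofReal]
  · have h3 : Ioo (0:ℝ) (min θ 1) = Iio θ ∩ Ioo 0 1 := by
      ext y; simp only [mem_Ioo, lt_min_iff, mem_inter_iff, mem_Iio]; tauto
    rw [h3, ← Measure.restrict_restrict measurableSet_Iio, ← lintegral_indicator measurableSet_Iio]
    rfl
  · exact ((intervalIntegrable_iff_integrableOn_Ioc_of_le hm).1 h2).mono_set Ioo_subset_Ioc_self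
  · filter_upwards [ae_restrict_mem measurableSet_Ioo] with y hy
    have : 0 < 1 - y := by linarith [hy.2, min_le_right θ 1]
    simp only [Pi.zero_apply]; positivity

/-- The regularised Beta integral `∫ θ^(-1-α) (1 − (1−θ)₊^γ) dθ`. -/
lemma lintegral_rpow_mul_one_sub_truncPow {γ α : ℝ} (hγ : 0 < γ) (hα0 : 0 < α) (hα1 : α < 1) :
    ∫⁻ θ in Ioi (0:ℝ), ENNReal.ofReal (θ ^ (-1 - α) * (1 - truncPow γ θ)) =
      ENNReal.ofReal (-(Real.Gamma (-α) * Real.Gamma (γ + 1) / Real.Gamma (γ + 1 - α))) := by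
  have h1 : ∀ θ ∈ Ioi (0:ℝ), ENNReal.ofReal (θ ^ (-1 - α) * (1 - truncPow γ θ)) =
      ∫⁻ y in Ioo (0:ℝ) 1, ENNReal.ofReal (γ * (1 - y) ^ (γ - 1)) *
        (Ioi y).indicator (fun θ => ENNReal.ofReal (θ ^ (-1 - α))) θ := by
    intro θ hθ
    have hθ : (0:ℝ) < θ := hθ
    rw [ENNReal.ofReal_mul (by positivity), one_sub_truncPow_eq_lintegral hγ hθ,
      ← lintegral_const_mul']
    · refine lintegral_congr fun y => ?_
      by_cases h : y < θ <;> simp [indicator, h, mul_comm]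
    · exact ENNReal.ofReal_ne_top
  rw [setLIntegral_congr_fun measurableSet_Ioi h1, lintegral_lintegral_swap]
  · have h2 : ∀ y ∈ Ioo (0:ℝ) 1, ∫⁻ θ in Ioi (0:ℝ), ENNReal.ofReal (γ * (1 - y) ^ (γ - 1)) *
        (Ioi y).indicator (fun θ => ENNReal.ofReal (θ ^ (-1 - α))) θ =
        ENNReal.ofReal (γ / α) * ENNReal.ofReal (y ^ (1 - α - 1) * (1 - y) ^ (γ - 1)) := by
      intro y hy
      have hy0 : 0 < y := hy.1
      have hy1 : 0 < 1 - y := by linarith [hy.2]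
      rw [lintegral_const_mul' _ _ ENNReal.ofReal_ne_top, lintegral_indicator measurableSet_Ioi,
        Measure.restrict_restrict measurableSet_Ioi,
        inter_eq_left.2 (Ioi_subset_Ioi hy0.le),
        ← ofReal_integral_eq_lintegral_ofReal (integrableOn_Ioi_rpow_of_lt (by linarith) hy0),
        integral_Ioi_rpow_of_lt (by linarith) hy0, ← ENNReal.ofReal_mul (by positivity),
        ← ENNReal.ofReal_mul (by positivity)]
      · congr 1
        rw [show -1 - α + 1 = -α by ring, show 1 - α - 1 = -α by ring]
        field_simp
      · filter_upwards [ae_restrict_mem measurableSet_Ioi] with t ht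
        have : 0 < t := hy0.trans ht
        simp only [Pi.zero_apply]; positivity
    rw [setLIntegral_congr_fun measurableSet_Ioo h2, lintegral_const_mul' _ _ ENNReal.ofReal_ne_top,
      lintegral_beta (by linarith) hγ, ← ENNReal.ofReal_mul (by positivity)]
    congr 1
    have h3 := Real.Gamma_add_one (s := -α) (by linarith)
    rw [Real.Gamma_add_one hγ.ne', show 1 - α = -α + 1 by ring, h3,
      show γ + 1 - α = -α + 1 + γ by ring]
    field_simp
  · refine Measurable.aemeasurable ?_
    unfold Function.uncurry
    refine Measurable.mul (by fun_prop) ?_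
    have : (fun a : ℝ × ℝ => (Ioi a.2).indicator (fun θ => ENNReal.ofReal (θ ^ (-1 - α))) a.1) =
        {a : ℝ × ℝ | a.2 < a.1}.indicator (fun a => ENNReal.ofReal (a.1 ^ (-1 - α))) := by
      ext a; simp [indicator]
    rw [this]
    exact Measurable.indicator (by fun_prop) (measurableSet_lt measurable_snd measurable_fst)

lemma lintegral_mellin_laplaceDefect {s γ α : ℝ} (hs : 0 < s) (hγ : 0 < γ) (hα0 : 0 < α)
    (hα1 : α < 1) :
    ∫⁻ x in Ioi (0:ℝ), ENNReal.ofReal (x ^ (α - 1) * laplaceDefect s γ x) =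
      ENNReal.ofReal (-(Real.Gamma (s + α) *
        (Real.Gamma (-α) * Real.Gamma (γ + 1) / Real.Gamma (γ + 1 - α)))) := by
  have h1 : ∀ x ∈ Ioi (0:ℝ), ENNReal.ofReal (x ^ (α - 1) * laplaceDefect s γ x) =
      ∫⁻ θ in Ioi (0:ℝ), ENNReal.ofReal (θ ^ (s - 1) * (1 - truncPow γ θ)) *
        ENNReal.ofReal (x ^ (s + α - 1) * Real.exp (-(θ * x))) := by
    intro x hx
    have hx : (0:ℝ) < x := hx
    rw [laplaceDefect, ← mul_assoc, ← Real.rpow_add hx, ENNReal.ofReal_mul (by positivity),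
      ofReal_integral_eq_lintegral_ofReal (integrableOn_laplaceDefect hs hγ hx),
      ← lintegral_const_mul' _ _ ENNReal.ofReal_ne_top]
    · refine setLIntegral_congr_fun measurableSet_Ioi fun θ hθ => ?_
      have hθ : (0:ℝ) < θ := hθ
      have := sub_nonneg.2 (truncPow_le_one hγ hθ.le)
      rw [← ENNReal.ofReal_mul (by positivity), ← ENNReal.ofReal_mul (by positivity)]
      congr 1
      rw [show α - 1 + s = s + α - 1 by ring, mul_comm x θ]; ring
    · filter_upwards [ae_restrict_mem measurableSet_Ioi] with θ hθ
      have hθ : (0:ℝ) < θ := hθ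
      have := sub_nonneg.2 (truncPow_le_one hγ hθ.le)
      simp only [Pi.zero_apply]; positivity
  rw [setLIntegral_congr_fun measurableSet_Ioi h1, lintegral_lintegral_swap]
  · have h2 : ∀ θ ∈ Ioi (0:ℝ), ∫⁻ x in Ioi (0:ℝ),
        ENNReal.ofReal (θ ^ (s - 1) * (1 - truncPow γ θ)) *
        ENNReal.ofReal (x ^ (s + α - 1) * Real.exp (-(θ * x))) =
        ENNReal.ofReal (Real.Gamma (s + α)) *
          ENNReal.ofReal (θ ^ (-1 - α) * (1 - truncPow γ θ)) := by
      intro θ hθ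
      have hθ : (0:ℝ) < θ := hθ
      have := sub_nonneg.2 (truncPow_le_one hγ hθ.le)
      have hG := Real.Gamma_pos_of_pos (show 0 < s + α by linarith)
      rw [lintegral_const_mul' _ _ ENNReal.ofReal_ne_top,
        lintegral_rpow_mul_exp_neg_mul (by linarith) hθ, ← ENNReal.ofReal_mul (by positivity),
        ← ENNReal.ofReal_mul (by positivity)]
      congr 1
      rw [show -1 - α = (s - 1) + (-(s + α)) by ring, Real.rpow_add hθ]
      ring
    have hG := Real.Gamma_pos_of_pos (show 0 < s + α by linarith)
    rw [setLIntegral_congr_fun measurableSet_Ioi h2, lintegral_const_mul' _ _ ENNReal.ofReal_ne_top,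
      lintegral_rpow_mul_one_sub_truncPow hγ hα0 hα1, ← ENNReal.ofReal_mul (by positivity), mul_neg]
  · exact Measurable.aemeasurable (by unfold Function.uncurry; fun_prop)

lemma mellin_laplaceDefect {s γ α : ℝ} (hs : 0 < s) (hγ : 0 < γ) (hα0 : 0 < α) (hα1 : α < 1) :
    IntegrableOn (fun x => x ^ (α - 1) * laplaceDefect s γ x) (Ioi 0) ∧
    ∫ x in Ioi (0:ℝ), x ^ (α - 1) * laplaceDefect s γ x =
      -(Real.Gamma (s + α) * (Real.Gamma (-α) * Real.Gamma (γ + 1) / Real.Gamma (γ + 1 - α))) := by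
  have h := lintegral_mellin_laplaceDefect hs hγ hα0 hα1
  have hnn : 0 ≤ᵐ[volume.restrict (Ioi (0:ℝ))] fun x => x ^ (α - 1) * laplaceDefect s γ x := by
    filter_upwards [ae_restrict_mem measurableSet_Ioi] with x hx
    have hx : (0:ℝ) < x := hx
    have := laplaceDefect_nonneg (s := s) hγ hx
    simp only [Pi.zero_apply]; positivity
  have hm : AEStronglyMeasurable (fun x => x ^ (α - 1) * laplaceDefect s γ x)
      (volume.restrict (Ioi (0:ℝ))) :=
    (Measurable.mul (by fun_prop) (measurable_laplaceDefect s γ)).aestronglyMeasurable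
  constructor
  · exact (lintegral_ofReal_ne_top_iff_integrable hm hnn).1 (by rw [h]; exact ENNReal.ofReal_ne_top)
  · rw [integral_eq_lintegral_of_nonneg_ae hnn hm, h, ENNReal.toReal_ofReal]
    have h1 := Real.Gamma_add_one (s := -α) (by linarith)
    have h2 := Real.Gamma_pos_of_pos (show 0 < -α + 1 by linarith)
    have h3 : Real.Gamma (-α) ≤ 0 := by
      by_contra hc
      push Not at hc
      nlinarith
    have h4 := Real.Gamma_pos_of_pos (show 0 < s + α by linarith)
    have h5 := Real.Gamma_pos_of_pos (show 0 < γ + 1 by linarith)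
    have h6 := Real.Gamma_pos_of_pos (show 0 < γ + 1 - α by linarith)
    rw [← mul_neg, ← neg_div, ← neg_mul]
    have : 0 ≤ -Real.Gamma (-α) := by linarith
    positivity

lemma laplaceTrunc_eq_integral_Ioo {s γ x : ℝ} (hγ : 0 < γ) :
    laplaceTrunc s γ x =
      ∫ θ in Ioo (0:ℝ) 1, θ ^ (s - 1) * (1 - θ) ^ γ * Real.exp (-(x * θ)) := by
  rw [laplaceTrunc, setIntegral_eq_of_subset_of_forall_sdiff_eq_zero measurableSet_Ioi
    Ioo_subset_Ioi_self]
  · exact setIntegral_congr_fun measurableSet_Ioo fun θ hθ => by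
      simp only [truncPow_of_le hθ.2.le]
  · intro θ hθ
    have : 1 ≤ θ := by
      by_contra hc
      push Not at hc
      exact hθ.2 ⟨hθ.1, hc⟩
    rw [truncPow_of_ge hγ this]
    ring

lemma image_mul_div_one_sub {u : ℝ} (hu : 0 < u) :
    (fun θ : ℝ => u * θ / (1 - θ)) '' Ioo 0 1 = Ioi 0 := by
  ext t
  constructor
  · rintro ⟨θ, hθ, rfl⟩
    have := hθ.1
    have : 0 < 1 - θ := by linarith [hθ.2]
    simp only [mem_Ioi]; positivity
  · intro ht
    have ht : 0 < t := ht
    refine ⟨t / (t + u), ⟨by positivity, (div_lt_one (by positivity)).2 (by linarith)⟩, ?_⟩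
    have : 1 - t / (t + u) = u / (t + u) := by field_simp; ring
    simp only [this]
    field_simp

lemma lintegral_rpow_mul_add_rpow_mul_exp {s p u X : ℝ} (hs : 0 < s) (hp : s < p) (hu : 0 < u)
    (hX : 0 < X) :
    ∫⁻ t in Ioi (0:ℝ), ENNReal.ofReal
      (t ^ (s - 1) * ((t + u) ^ (-p - 1) * Real.exp (-(t * u / (t + u)) * X))) =
      ENNReal.ofReal (u ^ (s - p - 1) * laplaceTrunc s (p - s) (u * X)) := by
  have hγ : 0 < p - s := by linarith
  have hder : ∀ θ ∈ Ioo (0:ℝ) 1, HasDerivWithinAt (fun θ : ℝ => u * θ / (1 - θ))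
      (u / (1 - θ)^2) (Ioo 0 1) θ := by
    intro θ hθ
    have h1 : 1 - θ ≠ 0 := by linarith [hθ.2]
    have := (((hasDerivAt_id θ).const_mul u).div ((hasDerivAt_id θ).const_sub 1) h1)
    refine (this.congr_deriv ?_).hasDerivWithinAt
    simp only [id]
    field_simp
    ring
  have hinj : InjOn (fun θ : ℝ => u * θ / (1 - θ)) (Ioo 0 1) := by
    intro x hx y hy hxy
    have h1 : 1 - x ≠ 0 := by linarith [hx.2]
    have h2 : 1 - y ≠ 0 := by linarith [hy.2]
    simp only at hxy
    rw [div_eq_div_iff h1 h2] at hxy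
    have : u * (x - y) = 0 := by linarith
    rcases mul_eq_zero.1 this with h | h <;> linarith
  rw [← image_mul_div_one_sub hu, lintegral_image_eq_lintegral_abs_deriv_mul measurableSet_Ioo
    hder hinj, ENNReal.ofReal_mul (by positivity), laplaceTrunc_eq_integral_Ioo hγ,
    ofReal_integral_eq_lintegral_ofReal, ← lintegral_const_mul' _ _ ENNReal.ofReal_ne_top]
  · refine setLIntegral_congr_fun measurableSet_Ioo fun θ hθ => ?_
    have h0 : 0 < θ := hθ.1
    have h1 : 0 < 1 - θ := by linarith [hθ.2]
    have h2 : u * θ / (1 - θ) + u = u / (1 - θ) := by field_simp; ring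
    have h3 : u * θ / (1 - θ) * u / (u / (1 - θ)) = u * θ := by field_simp
    rw [h2, h3, ← ENNReal.ofReal_mul (by positivity), ← ENNReal.ofReal_mul (by positivity),
      abs_of_pos (by positivity), Real.div_rpow (by positivity) h1.le,
      Real.div_rpow (by positivity) h1.le, Real.mul_rpow hu.le h0.le]
    congr 1
    have e1 : u ^ (s - p - 1) = u * u ^ (s - 1) * u ^ (-p - 1) := by
      rw [← Real.rpow_one_add' hu.le, ← Real.rpow_add hu]
      · congr 1; ring
      · intro h; linarith
    have e2 : (1 - θ) ^ (p - s) = ((1 - θ)^2)⁻¹ * ((1 - θ) ^ (s - 1))⁻¹ *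
        ((1 - θ) ^ (-p - 1))⁻¹ := by
      rw [← Real.rpow_neg h1.le, ← Real.rpow_neg h1.le, ← Real.rpow_two, ← Real.rpow_neg h1.le,
        ← Real.rpow_add h1, ← Real.rpow_add h1]
      congr 1; ring
    rw [e1, e2, show -(u * θ) * X = -(u * X * θ) by ring]
    field_simp
  · refine ((integrableOn_laplaceTrunc hs hγ (x := u * X) (by positivity)).mono_set
      Ioo_subset_Ioi_self).congr ?_
    filter_upwards [ae_restrict_mem measurableSet_Ioo] with θ hθ
    rw [truncPow_of_le hθ.2.le]
  · filter_upwards [ae_restrict_mem measurableSet_Ioo] with θ hθ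
    have h0 : 0 < θ := hθ.1
    have h1 : 0 < 1 - θ := by linarith [hθ.2]
    simp only [Pi.zero_apply]; positivity

/-- The density of the representation of `r ↦ (1 + r)^(-a) / r` as a Laplace transform. -/
def bracketDensity (a u : ℝ) : ℝ :=
  u ^ a / Real.Gamma a * ∫ y in Ioo (0:ℝ) 1, y ^ (a - 1) * Real.exp (-(u * y))

lemma measurable_bracketDensity (a : ℝ) : Measurable (bracketDensity a) := by
  unfold bracketDensity
  refine Measurable.mul (by fun_prop) ?_
  refine (StronglyMeasurable.integral_prod_right (f := fun u y : ℝ =>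
    y ^ (a - 1) * Real.exp (-(u * y))) ?_).measurable
  exact Measurable.stronglyMeasurable (by unfold Function.uncurry; fun_prop)

section
variable {a u : ℝ}

lemma integrableOn_bracketDensity (ha : 0 < a) (hu : 0 < u) :
    IntegrableOn (fun y : ℝ => y ^ (a - 1) * Real.exp (-(u * y))) (Ioo 0 1) :=
  (integrableOn_rpow_mul_exp_neg_mul ha hu).mono_set Ioo_subset_Ioi_self

lemma bracketDensity_nonneg (ha : 0 < a) (hu : 0 < u) : 0 ≤ bracketDensity a u := by
  have hG := Real.Gamma_pos_of_pos ha
  refine mul_nonneg (by positivity) (setIntegral_nonneg measurableSet_Ioo fun y hy => ?_)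
  have : 0 < y := hy.1
  positivity

lemma bracketDensity_le_one (ha : 0 < a) (hu : 0 < u) : bracketDensity a u ≤ 1 := by
  have hG := Real.Gamma_pos_of_pos ha
  have h := setIntegral_mono_set (integrableOn_rpow_mul_exp_neg_mul ha hu) (s := Ioo 0 1)
    (by
      filter_upwards [ae_restrict_mem measurableSet_Ioi] with y hy
      have : (0:ℝ) < y := hy
      simp only [Pi.zero_apply]; positivity) (Filter.Eventually.of_forall fun y hy => hy.1)
  rw [integral_rpow_mul_exp_neg_mul ha hu] at h
  calc bracketDensity a u ≤ u ^ a / Real.Gamma a * (u ^ (-a) * Real.Gamma a) := by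
        unfold bracketDensity; gcongr
    _ = u ^ a * u ^ (-a) := by field_simp
    _ = 1 := by rw [← Real.rpow_add hu]; simp

lemma integral_rpow_Ioo (ha : 0 < a) :
    IntegrableOn (fun y : ℝ => y ^ (a - 1)) (Ioo 0 1) ∧
    ∫ y in Ioo (0:ℝ) 1, y ^ (a - 1) = 1 / a := by
  constructor
  · exact ((intervalIntegrable_iff_integrableOn_Ioc_of_le zero_le_one).1
      (intervalIntegral.intervalIntegrable_rpow' (by linarith))).mono_set Ioo_subset_Ioc_self
  · rw [← integral_Ioc_eq_integral_Ioo, ← intervalIntegral.integral_of_le zero_le_one,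
      integral_rpow (Or.inl (by linarith))]
    simp [ha.ne']

lemma bracketDensity_le (ha : 0 < a) (hu : 0 < u) :
    bracketDensity a u ≤ u ^ a / Real.Gamma (a + 1) := by
  have hG := Real.Gamma_pos_of_pos ha
  have h := setIntegral_mono_on (integrableOn_bracketDensity ha hu) (integral_rpow_Ioo ha).1
    measurableSet_Ioo fun y hy => by
      have : 0 < y := hy.1
      exact mul_le_of_le_one_right (by positivity) (Real.exp_le_one_iff.2 (by
        have := mul_pos hu this; linarith))
  rw [(integral_rpow_Ioo ha).2] at h
  rw [Real.Gamma_add_one ha.ne']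
  calc bracketDensity a u ≤ u ^ a / Real.Gamma a * (1 / a) := by
        unfold bracketDensity; gcongr
    _ = _ := by field_simp

lemma le_bracketDensity (ha : 0 < a) (hu : 0 < u) :
    u ^ a / Real.Gamma (a + 1) - bracketDensity a u ≤ u ^ (a + 1) / Real.Gamma a := by
  have hG := Real.Gamma_pos_of_pos ha
  have h := setIntegral_mono_on
    ((integral_rpow_Ioo ha).1.sub ((integral_rpow_Ioo (a := a + 1) (by linarith)).1.const_mul u))
    (integrableOn_bracketDensity ha hu) measurableSet_Ioo fun y hy => by
      have h0 : 0 < y := hy.1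
      have h3 : y ^ (a + 1 - 1) = y ^ (a - 1) * y := by
        rw [← Real.rpow_add_one h0.ne']; congr 1; ring
      have h4 := Real.add_one_le_exp (-(u * y))
      simp only [Pi.sub_apply, h3]
      calc _ = y ^ (a - 1) * (-(u * y) + 1) := by ring
        _ ≤ _ := by gcongr
  rw [integral_sub' (integral_rpow_Ioo ha).1
    ((integral_rpow_Ioo (a := a + 1) (by linarith)).1.const_mul u), integral_const_mul,
    (integral_rpow_Ioo ha).2, (integral_rpow_Ioo (a := a + 1) (by linarith)).2] at h
  have h5 : u ^ a / Real.Gamma a * (1 / a - u * (1 / (a + 1))) ≤ bracketDensity a u := by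
    unfold bracketDensity; gcongr
  have h6 : u ^ a / Real.Gamma a * (u * (1 / (a + 1))) ≤ u ^ a / Real.Gamma a * (u * 1) := by
    gcongr
    rw [div_le_one (by linarith)]; linarith
  rw [Real.Gamma_add_one ha.ne', Real.rpow_add_one hu.ne']
  have h7 : u ^ a / (a * Real.Gamma a) = u ^ a / Real.Gamma a * (1 / a) := by field_simp
  rw [h7]
  have h8 : u ^ a * u / Real.Gamma a = u ^ a / Real.Gamma a * (u * 1) := by field_simp
  rw [h8]
  linarith

end

lemma lintegral_Ioo_rpow_mul_add_rpow {a M : ℝ} (ha : 1 < a) (hM : 0 < M) :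
    ∫⁻ y in Ioo (0:ℝ) 1, ENNReal.ofReal (y ^ (a - 1) * (y + M) ^ (-(a + 1))) =
      ENNReal.ofReal ((1 + M) ^ (-a) / (a * M)) := by
  have hder : ∀ y ∈ uIcc (0:ℝ) 1, HasDerivAt (fun y : ℝ => y ^ a * (y + M) ^ (-a) / (a * M))
      (y ^ (a - 1) * (y + M) ^ (-(a + 1))) y := by
    intro y hy
    rw [uIcc_of_le zero_le_one] at hy
    have h0 : 0 < y + M := by linarith [hy.1]
    have h1 := Real.hasDerivAt_rpow_const (x := y) (p := a) (Or.inr ha.le)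
    have h2 := ((hasDerivAt_id y).add_const M).rpow_const (p := -a) (Or.inl h0.ne')
    refine ((h1.mul h2).div_const (a * M)).congr_deriv ?_
    simp only [id]
    have e1 : (y + M) ^ (-a) = (y + M) ^ (-(a + 1)) * (y + M) := by
      rw [← Real.rpow_add_one h0.ne']; congr 1; ring
    have e2 : y ^ a = y ^ (a - 1) * y := by
      rw [← Real.rpow_add_one' hy.1 (by linarith)]; congr 1; ring
    rw [e1, show -a - 1 = -(a + 1) by ring, e2]
    field_simp
    ring
  have hcont : ContinuousOn (fun y : ℝ => y ^ (a - 1) * (y + M) ^ (-(a + 1))) (uIcc 0 1) := by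
    rw [uIcc_of_le zero_le_one]
    refine ContinuousOn.mul (ContinuousOn.rpow_const continuousOn_id fun y _ => Or.inr (by linarith))
      (ContinuousOn.rpow_const (by fun_prop) fun y hy => Or.inl (by linarith [hy.1]))
  have hI := intervalIntegral.integral_eq_sub_of_hasDerivAt hder hcont.intervalIntegrable
  rw [intervalIntegral.integral_of_le zero_le_one, integral_Ioc_eq_integral_Ioo] at hI
  rw [← ofReal_integral_eq_lintegral_ofReal, hI]
  · rw [Real.zero_rpow (by linarith), Real.one_rpow]; simp
  · exact ((intervalIntegrable_iff_integrableOn_Ioc_of_le zero_le_one).1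
      hcont.intervalIntegrable).mono_set Ioo_subset_Ioc_self
  · filter_upwards [ae_restrict_mem measurableSet_Ioo] with y hy
    have h0 : 0 < y := hy.1
    simp only [Pi.zero_apply]; positivity

lemma lintegral_bracketDensity_mul_exp {a M : ℝ} (ha : 1 < a) (hM : 0 < M) :
    ∫⁻ u in Ioi (0:ℝ), ENNReal.ofReal (bracketDensity a u * Real.exp (-u * M)) =
      ENNReal.ofReal ((1 + M) ^ (-a) / M) := by
  have ha0 : 0 < a := by linarith
  have hG := Real.Gamma_pos_of_pos ha0
  have h1 : ∀ u ∈ Ioi (0:ℝ), ENNReal.ofReal (bracketDensity a u * Real.exp (-u * M)) =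
      ∫⁻ y in Ioo (0:ℝ) 1, ENNReal.ofReal (y ^ (a - 1) / Real.Gamma a) *
        ENNReal.ofReal (u ^ (a + 1 - 1) * Real.exp (-((y + M) * u))) := by
    intro u hu
    have hu : (0:ℝ) < u := hu
    rw [bracketDensity, mul_right_comm, ENNReal.ofReal_mul (by positivity),
      ofReal_integral_eq_lintegral_ofReal (integrableOn_bracketDensity ha0 hu),
      ← lintegral_const_mul' _ _ ENNReal.ofReal_ne_top]
    · refine setLIntegral_congr_fun measurableSet_Ioo fun y hy => ?_
      have hy0 : 0 < y := hy.1
      rw [← ENNReal.ofReal_mul (by positivity), ← ENNReal.ofReal_mul (by positivity)]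
      congr 1
      rw [show -((y + M) * u) = -u * M + -(u * y) by ring, Real.exp_add, add_sub_cancel_right]
      ring
    · filter_upwards [ae_restrict_mem measurableSet_Ioo] with y hy
      have h0 : 0 < y := hy.1
      simp only [Pi.zero_apply]; positivity
  rw [setLIntegral_congr_fun measurableSet_Ioi h1, lintegral_lintegral_swap]
  · have h2 : ∀ y ∈ Ioo (0:ℝ) 1, ∫⁻ u in Ioi (0:ℝ), ENNReal.ofReal (y ^ (a - 1) / Real.Gamma a) *
        ENNReal.ofReal (u ^ (a + 1 - 1) * Real.exp (-((y + M) * u))) =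
        ENNReal.ofReal a * ENNReal.ofReal (y ^ (a - 1) * (y + M) ^ (-(a + 1))) := by
      intro y hy
      have hy0 : 0 < y := hy.1
      rw [lintegral_const_mul' _ _ ENNReal.ofReal_ne_top,
        lintegral_rpow_mul_exp_neg_mul (by linarith) (by positivity),
        ← ENNReal.ofReal_mul (by positivity), ← ENNReal.ofReal_mul (by positivity),
        Real.Gamma_add_one ha0.ne']
      congr 1
      field_simp
    rw [setLIntegral_congr_fun measurableSet_Ioo h2, lintegral_const_mul' _ _ ENNReal.ofReal_ne_top,
      lintegral_Ioo_rpow_mul_add_rpow ha hM, ← ENNReal.ofReal_mul (by positivity)]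
    congr 1
    field_simp
  · exact Measurable.aemeasurable (by unfold Function.uncurry; fun_prop)

lemma integrable_and_integral_eq_of_lintegral_eq {β : Type*} [MeasurableSpace β] {μ : Measure β}
    {f : β → ℝ} {c : ℝ} (hm : Measurable f) (hf : 0 ≤ᵐ[μ] f) (hc : 0 ≤ c)
    (h : ∫⁻ x, ENNReal.ofReal (f x) ∂μ = ENNReal.ofReal c) :
    Integrable f μ ∧ ∫ x, f x ∂μ = c := by
  constructor
  · exact (lintegral_ofReal_ne_top_iff_integrable hm.aestronglyMeasurable hf).1
      (by rw [h]; exact ENNReal.ofReal_ne_top)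
  · rw [integral_eq_lintegral_of_nonneg_ae hf hm.aestronglyMeasurable, h, ENNReal.toReal_ofReal hc]

section
variable {d : ℕ} {a s : ℝ}

lemma lintegral_bracket_mul_gramDet (hd : 1 ≤ d) (ha : 1 < a) (n : EuclideanSpace ℝ (Fin d)) :
    ∫⁻ m : EuclideanSpace ℝ (Fin d),
      ENNReal.ofReal ((1 + ‖m‖^2) ^ (-a) / ‖m‖^2 * gramDet n m) =
    ∫⁻ u in Ioi (0:ℝ), ENNReal.ofReal (((d:ℝ) - 1) / 2 * Real.pi ^ ((d:ℝ)/2) * ‖n‖^2 *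
      (bracketDensity a u * u ^ (-(d:ℝ)/2 - 1))) := by
  have : Nonempty (Fin d) := ⟨⟨0, by omega⟩⟩
  have hd1 : (0:ℝ) ≤ (d:ℝ) - 1 := by have : (1:ℝ) ≤ d := by exact_mod_cast hd
                                     linarith
  have h1 : ∀ᵐ m : EuclideanSpace ℝ (Fin d),
      ENNReal.ofReal ((1 + ‖m‖^2) ^ (-a) / ‖m‖^2 * gramDet n m) =
      ∫⁻ u in Ioi (0:ℝ), ENNReal.ofReal (bracketDensity a u) *
        ENNReal.ofReal (gramDet n m * (Real.exp (-u * ‖m‖^2) * Real.exp (-0 * ‖n - m‖^2))) := by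
    filter_upwards [Measure.ae_ne volume 0] with m hm
    have hm : 0 < ‖m‖ := norm_pos_iff.2 hm
    rw [ENNReal.ofReal_mul (by positivity), ← lintegral_bracketDensity_mul_exp ha (by positivity),
      mul_comm, ← lintegral_const_mul' _ _ ENNReal.ofReal_ne_top]
    refine setLIntegral_congr_fun measurableSet_Ioi fun u hu => ?_
    have h0 := bracketDensity_nonneg (a := a) (by linarith) hu
    rw [← ENNReal.ofReal_mul (gramDet_nonneg _ _), ← ENNReal.ofReal_mul h0]
    congr 1
    simp only [neg_zero, zero_mul, Real.exp_zero]; ring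
  rw [lintegral_congr_ae h1, lintegral_lintegral_swap]
  · refine setLIntegral_congr_fun measurableSet_Ioi fun u hu => ?_
    have h0 := bracketDensity_nonneg (a := a) (by linarith) hu
    rw [lintegral_const_mul' _ _ ENNReal.ofReal_ne_top,
      lintegral_gramDet_mul_exp_mul_exp hu le_rfl, ← ENNReal.ofReal_mul h0]
    congr 1
    simp only [zero_mul, zero_div, neg_zero, Real.exp_zero, zero_add]; ring
  · refine Measurable.aemeasurable ?_
    unfold Function.uncurry
    have := measurable_bracketDensity a
    fun_prop

lemma lintegral_bracket_mul_gramDet_mul_rpow (hd : 1 ≤ d) (ha : 1 < a) (hs : 0 < s)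
    (hsd : s < (d:ℝ)/2) {n : EuclideanSpace ℝ (Fin d)} (hn : n ≠ 0) :
    ∫⁻ m : EuclideanSpace ℝ (Fin d),
      ENNReal.ofReal ((1 + ‖m‖^2) ^ (-a) / ‖m‖^2 * gramDet n m * ‖n - m‖ ^ (-(2*s))) =
    ∫⁻ u in Ioi (0:ℝ), ENNReal.ofReal (((d:ℝ) - 1) / 2 * Real.pi ^ ((d:ℝ)/2) * ‖n‖^2 /
      Real.Gamma s * (bracketDensity a u *
        (u ^ (s - (d:ℝ)/2 - 1) * laplaceTrunc s ((d:ℝ)/2 - s) (u * ‖n‖^2)))) := by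
  have : Nonempty (Fin d) := ⟨⟨0, by omega⟩⟩
  have hd1 : (0:ℝ) ≤ (d:ℝ) - 1 := by have : (1:ℝ) ≤ d := by exact_mod_cast hd
                                     linarith
  have hG := Real.Gamma_pos_of_pos hs
  have hn0 : 0 < ‖n‖ := norm_pos_iff.2 hn
  have hφ := measurable_bracketDensity a
  have h1 : ∀ᵐ m : EuclideanSpace ℝ (Fin d),
      ENNReal.ofReal ((1 + ‖m‖^2) ^ (-a) / ‖m‖^2 * gramDet n m * ‖n - m‖ ^ (-(2*s))) =
      ∫⁻ u in Ioi (0:ℝ), ∫⁻ t in Ioi (0:ℝ),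
        ENNReal.ofReal (bracketDensity a u * (t ^ (s - 1) / Real.Gamma s)) *
        ENNReal.ofReal (gramDet n m * (Real.exp (-u * ‖m‖^2) * Real.exp (-t * ‖n - m‖^2))) := by
    filter_upwards [Measure.ae_ne volume 0, Measure.ae_ne volume n] with m hm hmn
    have hm : 0 < ‖m‖ := norm_pos_iff.2 hm
    have hmn : 0 < ‖n - m‖ := norm_pos_iff.2 (sub_ne_zero.2 (Ne.symm hmn))
    have hq := gramDet_nonneg n m
    have h2 : ∀ u ∈ Ioi (0:ℝ), (∫⁻ t in Ioi (0:ℝ),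
        ENNReal.ofReal (bracketDensity a u * (t ^ (s - 1) / Real.Gamma s)) *
        ENNReal.ofReal (gramDet n m * (Real.exp (-u * ‖m‖^2) * Real.exp (-t * ‖n - m‖^2)))) =
        ENNReal.ofReal (gramDet n m * ‖n - m‖ ^ (-(2*s))) *
          ENNReal.ofReal (bracketDensity a u * Real.exp (-u * ‖m‖^2)) := by
      intro u hu
      have h0 := bracketDensity_nonneg (a := a) (by linarith) hu
      have h3 : ‖n - m‖ ^ (-(2*s)) = (‖n - m‖^2) ^ (-s) := by
        rw [← Real.rpow_natCast, ← Real.rpow_mul hmn.le]; congr 1; push_cast; ring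
      have h4 : ENNReal.ofReal (gramDet n m * ‖n - m‖ ^ (-(2*s))) *
          ENNReal.ofReal (bracketDensity a u * Real.exp (-u * ‖m‖^2)) =
          ENNReal.ofReal (gramDet n m * (bracketDensity a u * Real.exp (-u * ‖m‖^2)) /
            Real.Gamma s) * ENNReal.ofReal ((‖n - m‖^2) ^ (-s) * Real.Gamma s) := by
        rw [← ENNReal.ofReal_mul (by positivity), ← ENNReal.ofReal_mul (by positivity), h3]
        congr 1
        field_simp
      rw [h4, ← lintegral_rpow_mul_exp_neg_mul hs (by positivity),
        ← lintegral_const_mul' _ _ ENNReal.ofReal_ne_top]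
      refine setLIntegral_congr_fun measurableSet_Ioi fun t ht => ?_
      have ht : (0:ℝ) < t := ht
      rw [← ENNReal.ofReal_mul (by positivity), ← ENNReal.ofReal_mul (by positivity)]
      congr 1
      rw [show -(‖n - m‖^2 * t) = -t * ‖n - m‖^2 by ring]
      ring
    rw [setLIntegral_congr_fun measurableSet_Ioi h2,
      lintegral_const_mul' _ _ ENNReal.ofReal_ne_top,
      lintegral_bracketDensity_mul_exp ha (by positivity), ← ENNReal.ofReal_mul (by positivity)]
    congr 1
    ring
  have hmeas : Measurable (fun z : (EuclideanSpace ℝ (Fin d) × ℝ) × ℝ =>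
      ENNReal.ofReal (bracketDensity a z.1.2 * (z.2 ^ (s - 1) / Real.Gamma s)) *
        ENNReal.ofReal (gramDet n z.1.1 * (Real.exp (-z.1.2 * ‖z.1.1‖^2) *
          Real.exp (-z.2 * ‖n - z.1.1‖^2)))) := by
    fun_prop
  rw [lintegral_congr_ae h1, lintegral_lintegral_swap]
  · refine setLIntegral_congr_fun measurableSet_Ioi fun u hu => ?_
    have hu : (0:ℝ) < u := hu
    have h0 := bracketDensity_nonneg (a := a) (by linarith) hu
    rw [lintegral_lintegral_swap]
    · have h5 : ∀ t ∈ Ioi (0:ℝ), (∫⁻ m : EuclideanSpace ℝ (Fin d),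
          ENNReal.ofReal (bracketDensity a u * (t ^ (s - 1) / Real.Gamma s)) *
          ENNReal.ofReal (gramDet n m *
            (Real.exp (-u * ‖m‖^2) * Real.exp (-t * ‖n - m‖^2)))) =
          ENNReal.ofReal (((d:ℝ) - 1) / 2 * Real.pi ^ ((d:ℝ)/2) * ‖n‖^2 / Real.Gamma s *
            bracketDensity a u) * ENNReal.ofReal (t ^ (s - 1) * ((t + u) ^ (-((d:ℝ)/2) - 1) *
              Real.exp (-(t * u / (t + u)) * ‖n‖^2))) := by
        intro t ht
        have ht : (0:ℝ) < t := ht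
        rw [lintegral_const_mul' _ _ ENNReal.ofReal_ne_top,
          lintegral_gramDet_mul_exp_mul_exp hu ht.le, ← ENNReal.ofReal_mul (by positivity),
          ← ENNReal.ofReal_mul (by positivity), neg_div]
        congr 1
        ring
      rw [setLIntegral_congr_fun measurableSet_Ioi h5,
        lintegral_const_mul' _ _ ENNReal.ofReal_ne_top,
        lintegral_rpow_mul_add_rpow_mul_exp hs hsd hu (by positivity),
        ← ENNReal.ofReal_mul (by positivity)]
      congr 1
      ring
    · refine Measurable.aemeasurable ?_
      unfold Function.uncurry
      fun_prop
  · exact (Measurable.lintegral_prod_right' hmeas).aemeasurable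

end

section
variable {p α u : ℝ}

lemma bracketDensity_mul_rpow_le (hp : 0 < p) (hα : 0 < α) (hu : 0 < u) :
    bracketDensity (p + α) u * u ^ (-p - 1) ≤ u ^ (α - 1) / Real.Gamma (p + α + 1) := by
  have h := bracketDensity_le (a := p + α) (by linarith) hu
  calc _ ≤ u ^ (p + α) / Real.Gamma (p + α + 1) * u ^ (-p - 1) := by gcongr
    _ = u ^ (p + α) * u ^ (-p - 1) / Real.Gamma (p + α + 1) := by ring
    _ = _ := by rw [← Real.rpow_add hu]; congr 2; ring

lemma sub_bracketDensity_mul_rpow_le (hp : 0 < p) (hα : 0 < α) (hu : 0 < u) :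
    u ^ (α - 1) / Real.Gamma (p + α + 1) - bracketDensity (p + α) u * u ^ (-p - 1) ≤
      u ^ α / Real.Gamma (p + α) := by
  have h := le_bracketDensity (a := p + α) (by linarith) hu
  have e1 : u ^ (α - 1) = u ^ (p + α) * u ^ (-p - 1) := by
    rw [← Real.rpow_add hu]; congr 1; ring
  have e2 : u ^ α = u ^ (p + α + 1) * u ^ (-p - 1) := by
    rw [← Real.rpow_add hu]; congr 1; ring
  rw [e1, e2]
  calc _ = (u ^ (p + α) / Real.Gamma (p + α + 1) - bracketDensity (p + α) u) * u ^ (-p - 1) := by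
        ring
    _ ≤ u ^ (p + α + 1) / Real.Gamma (p + α) * u ^ (-p - 1) := by gcongr
    _ = _ := by ring

lemma integrableOn_Ioi_of_le_rpow {f : ℝ → ℝ} {b c B C : ℝ} (hf : Measurable f) (hb : 0 < b)
    (hc : 0 < c) (hf0 : ∀ u : ℝ, 0 < u → 0 ≤ f u) (hB : ∀ u : ℝ, 0 < u → f u ≤ B * u ^ (b - 1))
    (hC : ∀ u : ℝ, 0 < u → f u ≤ C * u ^ (-c - 1)) : IntegrableOn f (Ioi 0) := by
  rw [← Ioc_union_Ioi_eq_Ioi zero_le_one]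
  refine IntegrableOn.union ?_ ?_
  · have h := ((intervalIntegrable_iff_integrableOn_Ioc_of_le zero_le_one).1
      (intervalIntegral.intervalIntegrable_rpow' (r := b - 1) (by linarith)))
    refine Integrable.mono' (h.const_mul B) hf.aestronglyMeasurable ?_
    filter_upwards [ae_restrict_mem measurableSet_Ioc] with u hu
    rw [Real.norm_of_nonneg (hf0 u hu.1)]
    exact hB u hu.1
  · have h := integrableOn_Ioi_rpow_of_lt (a := -c - 1) (c := 1) (by linarith) one_pos
    refine Integrable.mono' (h.const_mul C) hf.aestronglyMeasurable ?_
    filter_upwards [ae_restrict_mem measurableSet_Ioi] with u hu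
    have hu : 0 < u := one_pos.trans hu
    rw [Real.norm_of_nonneg (hf0 u hu)]
    exact hC u hu

lemma integrableOn_bracketDensity_mul_rpow (hp : 0 < p) (hα : 0 < α) :
    IntegrableOn (fun u => bracketDensity (p + α) u * u ^ (-p - 1)) (Ioi 0) := by
  have hφ := measurable_bracketDensity (p + α)
  refine integrableOn_Ioi_of_le_rpow (b := α) (c := p) (B := 1 / Real.Gamma (p + α + 1)) (C := 1)
    (by fun_prop) hα hp (fun u hu => ?_) (fun u hu => ?_) fun u hu => ?_
  · have := bracketDensity_nonneg (a := p + α) (by linarith) hu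
    positivity
  · refine (bracketDensity_mul_rpow_le hp hα hu).trans_eq ?_
    ring
  · have := bracketDensity_le_one (a := p + α) (by linarith) hu
    gcongr

lemma integrableOn_sub_bracketDensity_div (hp : 0 < p) (hα0 : 0 < α) (hα1 : α < 1) :
    IntegrableOn (fun u => (u ^ (α - 1) / Real.Gamma (p + α + 1) -
      bracketDensity (p + α) u * u ^ (-p - 1)) / u) (Ioi 0) := by
  have hφ := measurable_bracketDensity (p + α)
  refine integrableOn_Ioi_of_le_rpow (b := α) (c := 1 - α) (B := 1 / Real.Gamma (p + α))
    (C := 1 / Real.Gamma (p + α + 1)) (by fun_prop) hα0 (by linarith) (fun u hu => ?_)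
    (fun u hu => ?_) fun u hu => ?_
  · have := sub_nonneg.2 (bracketDensity_mul_rpow_le hp hα0 hu)
    positivity
  · have := sub_bracketDensity_mul_rpow_le hp hα0 hu
    rw [Real.rpow_sub_one hu.ne' α, div_le_iff₀ hu]
    rw [Real.rpow_sub_one hu.ne' α] at this
    refine this.trans_eq ?_
    field_simp
  · have := bracketDensity_nonneg (a := p + α) (by linarith) hu
    have h1 : u ^ (-(1 - α) - 1) = u ^ (α - 1) / u := by
      rw [← Real.rpow_sub_one hu.ne']; congr 1; ring
    rw [h1, div_le_iff₀ hu]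
    have h2 : 1 / Real.Gamma (p + α + 1) * (u ^ (α - 1) / u) * u =
      u ^ (α - 1) / Real.Gamma (p + α + 1) := by field_simp
    rw [h2]
    have : 0 ≤ bracketDensity (p + α) u * u ^ (-p - 1) := by positivity
    linarith

end

section
variable {p s γ α X : ℝ}

lemma integrableOn_rpow_mul_laplaceDefect_comp (hs : 0 < s) (hγ : 0 < γ) (hα0 : 0 < α)
    (hα1 : α < 1) (hX : 0 < X) :
    IntegrableOn (fun u => u ^ (α - 1) * laplaceDefect s γ (u * X)) (Ioi 0) ∧
    ∫ u in Ioi (0:ℝ), u ^ (α - 1) * laplaceDefect s γ (u * X) =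
      X ^ (-α) * ∫ x in Ioi (0:ℝ), x ^ (α - 1) * laplaceDefect s γ x := by
  have h := (mellin_laplaceDefect hs hγ hα0 hα1).1
  have hcongr : ∀ u ∈ Ioi (0:ℝ), X ^ (1 - α) *
      ((fun x => x ^ (α - 1) * laplaceDefect s γ x) (X * u)) =
      u ^ (α - 1) * laplaceDefect s γ (u * X) := by
    intro u hu
    have hu : (0:ℝ) < u := hu
    simp only
    rw [Real.mul_rpow hX.le hu.le, mul_comm X u, ← mul_assoc, ← mul_assoc, ← Real.rpow_add hX]
    simp
  constructor
  · refine IntegrableOn.congr_fun (Integrable.const_mul ?_ (X ^ (1 - α))) hcongr measurableSet_Ioi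
    exact (integrableOn_Ioi_comp_mul_left_iff
      (fun x => x ^ (α - 1) * laplaceDefect s γ x) 0 hX).2 (by simpa using h)
  · rw [← setIntegral_congr_fun measurableSet_Ioi hcongr, integral_const_mul,
      integral_comp_mul_left_Ioi (fun x => x ^ (α - 1) * laplaceDefect s γ x) 0 hX, mul_zero,
      smul_eq_mul, ← mul_assoc]
    congr 1
    rw [← Real.rpow_neg_one X, ← Real.rpow_add hX]
    congr 1; ring

lemma integrableOn_bracketDensity_mul_laplaceDefect (hp : 0 < p) (hs : 0 < s) (hγ : 0 < γ)
    (hα0 : 0 < α) (hX : 0 < X) :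
    IntegrableOn (fun u => bracketDensity (p + α) u * u ^ (-p - 1) * laplaceDefect s γ (u * X))
      (Ioi 0) := by
  have hφ := measurable_bracketDensity (p + α)
  have hD := measurable_laplaceDefect s γ
  refine Integrable.mono' ((integrableOn_bracketDensity_mul_rpow hp hα0).mul_const (Real.Gamma s))
    (Measurable.aestronglyMeasurable (by fun_prop)) ?_
  filter_upwards [ae_restrict_mem measurableSet_Ioi] with u hu
  have hu : (0:ℝ) < u := hu
  have hx : 0 < u * X := by positivity
  have h1 := laplaceDefect_nonneg (s := s) hγ hx
  have h2 := laplaceDefect_add hs hγ hx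
  have h3 := laplaceTrunc_nonneg s γ (u * X)
  have h4 := bracketDensity_nonneg (a := p + α) (by linarith) hu
  have h5 : 0 ≤ (u * X) ^ s * laplaceTrunc s γ (u * X) := by positivity
  rw [Real.norm_of_nonneg (by positivity)]
  gcongr
  linarith

lemma exists_abs_integral_bracketDensity_mul_laplaceDefect_sub_le (hp : 0 < p) (hs : 0 < s)
    (hγ : 0 < γ) (hα0 : 0 < α) (hα1 : α < 1) :
    ∃ ρ : ℝ, 0 ≤ ρ ∧ ∀ X : ℝ, 0 < X →
      |(∫ u in Ioi (0:ℝ), bracketDensity (p + α) u * u ^ (-p - 1) * laplaceDefect s γ (u * X)) -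
        X ^ (-α) / Real.Gamma (p + α + 1) * (-(Real.Gamma (s + α) *
          (Real.Gamma (-α) * Real.Gamma (γ + 1) / Real.Gamma (γ + 1 - α))))| ≤ ρ / X := by
  set e : ℝ → ℝ := fun u => u ^ (α - 1) / Real.Gamma (p + α + 1) -
      bracketDensity (p + α) u * u ^ (-p - 1) with he
  have he0 : ∀ u ∈ Ioi (0:ℝ), 0 ≤ e u := fun u hu =>
    sub_nonneg.2 (bracketDensity_mul_rpow_le hp hα0 hu)
  have heI := integrableOn_sub_bracketDensity_div hp hα0 hα1
  have hG := Real.Gamma_pos_of_pos (show 0 < s + 1 by linarith)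
  refine ⟨(γ + 1) * Real.Gamma (s + 1) * ∫ u in Ioi (0:ℝ), e u / u, ?_, fun X hX => ?_⟩
  · refine mul_nonneg (by positivity) (setIntegral_nonneg measurableSet_Ioi fun u hu => ?_)
    have := he0 u hu
    have hu : (0:ℝ) < u := hu
    positivity
  obtain ⟨hI, hV⟩ := integrableOn_rpow_mul_laplaceDefect_comp hs hγ hα0 hα1 hX
  have hJ := integrableOn_bracketDensity_mul_laplaceDefect hp hs hγ hα0 hX
  rw [(mellin_laplaceDefect hs hγ hα0 hα1).2] at hV
  rw [div_mul_eq_mul_div, ← hV, abs_sub_comm, ← integral_div, ← integral_sub (hI.div_const _) hJ]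
  have hbound : ∀ u ∈ Ioi (0:ℝ), ‖u ^ (α - 1) * laplaceDefect s γ (u * X) /
      Real.Gamma (p + α + 1) - bracketDensity (p + α) u * u ^ (-p - 1) *
        laplaceDefect s γ (u * X)‖ ≤ (γ + 1) * Real.Gamma (s + 1) / X * (e u / u) := by
    intro u hu
    have h0 := he0 u hu
    have hu : (0:ℝ) < u := hu
    have h1 := laplaceDefect_nonneg (s := s) hγ (show 0 < u * X by positivity)
    have h2 := laplaceDefect_le hs hγ (show 0 < u * X by positivity)
    have h3 : u ^ (α - 1) * laplaceDefect s γ (u * X) / Real.Gamma (p + α + 1) -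
      bracketDensity (p + α) u * u ^ (-p - 1) * laplaceDefect s γ (u * X) =
        e u * laplaceDefect s γ (u * X) := by simp only [he]; ring
    rw [h3, Real.norm_of_nonneg (by positivity)]
    calc _ ≤ e u * ((γ + 1) * Real.Gamma (s + 1) / (u * X)) := by gcongr
      _ = _ := by field_simp
  have h := norm_integral_le_of_norm_le (heI.const_mul ((γ + 1) * Real.Gamma (s + 1) / X))
    ((ae_restrict_iff' measurableSet_Ioi).2 (Filter.Eventually.of_forall hbound))
  rw [integral_const_mul, Real.norm_eq_abs] at h
  exact h.trans_eq (by ring)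

end

/-- The transport integral as a one-dimensional integral. -/
lemma integral_transport_eq {d : ℕ} (hd : 2 ≤ d) {s α : ℝ} (hs0 : 0 < s) (hsd : s < (d : ℝ)/2)
    (hα0 : 0 < α) {n : EuclideanSpace ℝ (Fin d)} (hn : n ≠ 0) :
    (∫ k : EuclideanSpace ℝ (Fin d),
      jap (n - k) ^ (-(d : ℝ) - 2*α) * (‖k‖ ^ (-(2*s)) - ‖n‖ ^ (-(2*s))) * ‖Pperp (n - k) k‖^2) =
    -(((d:ℝ) - 1) / 2 * Real.pi ^ ((d:ℝ)/2) * ‖n‖^2 * (‖n‖^2) ^ (-s) / Real.Gamma s *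
      ∫ u in Ioi (0:ℝ), bracketDensity ((d:ℝ)/2 + α) u * u ^ (-((d:ℝ)/2) - 1) *
        laplaceDefect s ((d:ℝ)/2 - s) (u * ‖n‖^2)) := by
  have hd2 : (2:ℝ) ≤ d := by exact_mod_cast hd
  have hd1 : (0:ℝ) ≤ (d:ℝ) - 1 := by linarith
  have : Nonempty (Fin d) := ⟨⟨0, by omega⟩⟩
  have hn0 : 0 < ‖n‖ := norm_pos_iff.2 hn
  set X := ‖n‖^2 with hX
  have hX0 : 0 < X := by positivity
  set K := ((d:ℝ) - 1) / 2 * Real.pi ^ ((d:ℝ)/2) with hK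
  have hK0 : 0 ≤ K := by positivity
  set p := (d:ℝ)/2 with hp
  have hp1 : 1 ≤ p := by rw [hp]; linarith
  have hγ : 0 < p - s := by linarith
  have hG := Real.Gamma_pos_of_pos hs0
  have hH := integrableOn_bracketDensity_mul_rpow (p := p) (by linarith) hα0
  have hHD := integrableOn_bracketDensity_mul_laplaceDefect (p := p) (by linarith) hs0 hγ hα0 hX0
  have hφ0 : ∀ u ∈ Ioi (0:ℝ), 0 ≤ bracketDensity (p + α) u := fun u hu =>
    bracketDensity_nonneg (by linarith) hu
  -- the integral of the weight
  have hB : ∫⁻ m : EuclideanSpace ℝ (Fin d),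
      ENNReal.ofReal ((1 + ‖m‖^2) ^ (-(p + α)) / ‖m‖^2 * gramDet n m) =
      ENNReal.ofReal (K * X * ∫ u in Ioi (0:ℝ), bracketDensity (p + α) u * u ^ (-p - 1)) := by
    rw [lintegral_bracket_mul_gramDet (by omega) (by linarith), ← integral_const_mul,
      ofReal_integral_eq_lintegral_ofReal (hH.const_mul _)]
    · rw [neg_div]
    · filter_upwards [ae_restrict_mem measurableSet_Ioi] with u hu
      have h0 := hφ0 u hu
      have hu : (0:ℝ) < u := hu
      simp only [Pi.zero_apply]; positivity
  have hrep : ∀ u ∈ Ioi (0:ℝ), K * X / Real.Gamma s * (bracketDensity (p + α) u *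
      (u ^ (s - p - 1) * laplaceTrunc s (p - s) (u * X))) =
      K * X / Real.Gamma s * X ^ (-s) *
        (Real.Gamma s * (bracketDensity (p + α) u * u ^ (-p - 1)) -
        bracketDensity (p + α) u * u ^ (-p - 1) * laplaceDefect s (p - s) (u * X)) := by
    intro u hu
    have hu : (0:ℝ) < u := hu
    have h1 := laplaceDefect_add hs0 hγ (show 0 < u * X by positivity)
    have h2 : u ^ (s - p - 1) = u ^ s * u ^ (-p - 1) := by
      rw [← Real.rpow_add hu]; congr 1; ring
    have h3 : X ^ (-s) * X ^ s = 1 := by rw [← Real.rpow_add hX0]; simp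
    rw [Real.mul_rpow hu.le hX0.le] at h1
    have h4 : Real.Gamma s * (bracketDensity (p + α) u * u ^ (-p - 1)) -
        bracketDensity (p + α) u * u ^ (-p - 1) * laplaceDefect s (p - s) (u * X) =
        bracketDensity (p + α) u * u ^ (-p - 1) *
          (u ^ s * X ^ s * laplaceTrunc s (p - s) (u * X)) := by
      rw [← h1]; ring
    rw [h4, h2]
    linear_combination (-(K * X / Real.Gamma s * (bracketDensity (p + α) u * u ^ (-p - 1)) *
      u ^ s * laplaceTrunc s (p - s) (u * X))) * h3
  have hrepI : IntegrableOn (fun u => K * X / Real.Gamma s * (bracketDensity (p + α) u *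
      (u ^ (s - p - 1) * laplaceTrunc s (p - s) (u * X)))) (Ioi 0) :=
    IntegrableOn.congr_fun (((hH.const_mul _).sub hHD).const_mul _)
      (fun u hu => (hrep u hu).symm) measurableSet_Ioi
  have hrepn : ∀ u ∈ Ioi (0:ℝ), 0 ≤ K * X / Real.Gamma s * (bracketDensity (p + α) u *
      (u ^ (s - p - 1) * laplaceTrunc s (p - s) (u * X))) := by
    intro u hu
    have h0 := hφ0 u hu
    have h1 := laplaceTrunc_nonneg s (p - s) (u * X)
    have hu : (0:ℝ) < u := hu
    positivity
  have hA : ∫⁻ m : EuclideanSpace ℝ (Fin d), ENNReal.ofReal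
      ((1 + ‖m‖^2) ^ (-(p + α)) / ‖m‖^2 * gramDet n m * ‖n - m‖ ^ (-(2*s))) =
      ENNReal.ofReal (∫ u in Ioi (0:ℝ), K * X / Real.Gamma s * (bracketDensity (p + α) u *
      (u ^ (s - p - 1) * laplaceTrunc s (p - s) (u * X)))) := by
    rw [lintegral_bracket_mul_gramDet_mul_rpow (by omega) (by linarith) hs0 hsd hn,
      ofReal_integral_eq_lintegral_ofReal hrepI]
    filter_upwards [ae_restrict_mem measurableSet_Ioi] with u hu using hrepn u hu
  obtain ⟨hBI, hBV⟩ := integrable_and_integral_eq_of_lintegral_eq (by fun_prop)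
    (Filter.Eventually.of_forall fun m => by
      have := gramDet_nonneg n m
      simp only [Pi.zero_apply]; positivity)
    (mul_nonneg (by positivity) (setIntegral_nonneg measurableSet_Ioi fun u hu => by
      have h0 := hφ0 u hu
      have hu : (0:ℝ) < u := hu
      positivity)) hB
  obtain ⟨hAI, hAV⟩ := integrable_and_integral_eq_of_lintegral_eq (by fun_prop)
    (Filter.Eventually.of_forall fun m => by
      have := gramDet_nonneg n m
      simp only [Pi.zero_apply]; positivity)
    (setIntegral_nonneg measurableSet_Ioi hrepn) hA
  rw [← integral_sub_left_eq_self _ volume n]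
  have hae : ∀ᵐ m : EuclideanSpace ℝ (Fin d),
      jap (n - (n - m)) ^ (-(d : ℝ) - 2*α) * (‖n - m‖ ^ (-(2*s)) - ‖n‖ ^ (-(2*s))) *
        ‖Pperp (n - (n - m)) (n - m)‖^2 =
      (1 + ‖m‖^2) ^ (-(p + α)) / ‖m‖^2 * gramDet n m * ‖n - m‖ ^ (-(2*s)) -
        ‖n‖ ^ (-(2*s)) * ((1 + ‖m‖^2) ^ (-(p + α)) / ‖m‖^2 * gramDet n m) := by
    filter_upwards [Measure.ae_ne volume 0] with m hm
    have h1 : jap m ^ (-(d : ℝ) - 2*α) = (1 + ‖m‖^2) ^ (-(p + α)) := by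
      rw [jap, Real.sqrt_eq_rpow, ← Real.rpow_mul (by positivity), hp]
      congr 1; ring
    rw [sub_sub_cancel, normSq_Pperp_sub n m hm, h1]
    ring
  rw [integral_congr_ae hae, integral_sub hAI (hBI.const_mul _), integral_const_mul, hAV, hBV,
    setIntegral_congr_fun measurableSet_Ioi hrep, integral_const_mul,
    integral_sub (hH.const_mul _) hHD, integral_const_mul]
  have h3 : ‖n‖ ^ (-(2*s)) = X ^ (-s) := by
    rw [hX, ← Real.rpow_natCast, ← Real.rpow_mul hn0.le]; congr 1; push_cast; ring
  rw [h3]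
  field_simp
  ring

/-- Asymptotics of the transport integral: with
`I_tra(n) = ∫ ⟨n−k⟩^{−d−2α} (|k|^{−2s} − |n|^{−2s}) |P⊥_{n−k}k|² dk` and
`c_tra = −(d−1)(s+α−1)(d+2−2s−2α) C_{d,s,α}`, there are `R ≥ 1`, `ρ ≥ 0` with
`|I_tra(n) − c_tra |n|^{−2s+2−2α}| ≤ ρ |n|^{−2s}` for `|n| ≥ R`. -/
theorem stmt5 (d : ℕ) (hd : 2 ≤ d) (s α : ℝ) (hs0 : 0 < s) (hsd : s < (d : ℝ)/2)
    (hα0 : 0 < α) (hα1 : α < 1) (hsα : 1 < s + α) :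
    ∃ R ρ : ℝ, 1 ≤ R ∧ 0 ≤ ρ ∧ ∀ n : EuclideanSpace ℝ (Fin d), R ≤ ‖n‖ →
      |(∫ k : EuclideanSpace ℝ (Fin d),
          jap (n - k) ^ (-(d : ℝ) - 2*α) * (‖k‖ ^ (-(2*s)) - ‖n‖ ^ (-(2*s)))
            * ‖Pperp (n - k) k‖^2)
          - (-((d : ℝ) - 1)*(s + α - 1)*((d : ℝ) + 2 - 2*s - 2*α) * Cconst d s α)
            * ‖n‖ ^ (-(2*s) + 2 - 2*α)|
        ≤ ρ * ‖n‖ ^ (-(2*s)) := by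
  have hd2 : (2:ℝ) ≤ d := by exact_mod_cast hd
  have hd1 : (0:ℝ) ≤ (d:ℝ) - 1 := by linarith
  have hG := Real.Gamma_pos_of_pos hs0
  obtain ⟨ρ, hρ, hest⟩ := exists_abs_integral_bracketDensity_mul_laplaceDefect_sub_le
    (p := (d:ℝ)/2) (γ := (d:ℝ)/2 - s) (by linarith) hs0 (by linarith) hα0 hα1
  refine ⟨1, ((d:ℝ) - 1) / 2 * Real.pi ^ ((d:ℝ)/2) / Real.Gamma s * ρ, le_rfl, by positivity,
    fun n hn => ?_⟩
  have hn0 : 0 < ‖n‖ := by linarith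
  have hX0 : 0 < ‖n‖^2 := by positivity
  rw [integral_transport_eq hd hs0 hsd hα0 (norm_pos_iff.1 hn0)]
  have h3 : ‖n‖ ^ (-(2*s)) = (‖n‖^2) ^ (-s) := by
    rw [← Real.rpow_natCast, ← Real.rpow_mul hn0.le]; congr 1; push_cast; ring
  have h4 : ‖n‖ ^ (-(2*s) + 2 - 2*α) = ‖n‖^2 * (‖n‖^2) ^ (-s) * (‖n‖^2) ^ (-α) := by
    rw [mul_assoc, ← Real.rpow_add hX0, ← Real.rpow_natCast, ← Real.rpow_mul hn0.le,
      ← Real.rpow_add hn0]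
    congr 1; push_cast; ring
  have hC : -((d : ℝ) - 1)*(s + α - 1)*((d : ℝ) + 2 - 2*s - 2*α) * Cconst d s α =
      ((d:ℝ) - 1) / 2 * Real.pi ^ ((d:ℝ)/2) / Real.Gamma s * (1 / Real.Gamma ((d:ℝ)/2 + α + 1) *
        (Real.Gamma (s + α) * (Real.Gamma (-α) * Real.Gamma ((d:ℝ)/2 - s + 1) /
          Real.Gamma ((d:ℝ)/2 - s + 1 - α)))) := by
    have hb : 0 < (d:ℝ)/2 - s + 1 - α := by linarith
    have g1 := Real.Gamma_add_one (s := s + α - 1) (by linarith)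
    have g2 := Real.Gamma_add_one hb.ne'
    have g3 := Real.Gamma_pos_of_pos hb
    have g4 := Real.Gamma_pos_of_pos (show 0 < (d:ℝ)/2 + α + 1 by linarith)
    rw [sub_add_cancel] at g1
    rw [Cconst, show ((d:ℝ) - 2*s + 2)/2 = (d:ℝ)/2 - s + 1 by ring,
      show ((d:ℝ) + 2 + 2*α)/2 = (d:ℝ)/2 + α + 1 by ring,
      show ((d:ℝ) + 4 - 2*s - 2*α)/2 = (d:ℝ)/2 - s + 1 - α + 1 by ring, g1, g2,
      show (d:ℝ) + 2 - 2*s - 2*α = 2 * ((d:ℝ)/2 - s + 1 - α) by ring]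
    generalize Real.Gamma ((d:ℝ)/2 - s + 1 - α) = G at g3 ⊢
    generalize (d:ℝ)/2 - s + 1 - α = B at hb ⊢
    field_simp
    ring
  have he := hest (‖n‖^2) hX0
  rw [hC, h3, h4]
  set Y := (‖n‖^2) ^ (-s)
  set Z := (‖n‖^2) ^ (-α)
  set J := ∫ u in Ioi (0:ℝ), bracketDensity ((d:ℝ)/2 + α) u * u ^ (-((d:ℝ)/2) - 1) *
        laplaceDefect s ((d:ℝ)/2 - s) (u * ‖n‖^2)
  set V := Real.Gamma (s + α) * (Real.Gamma (-α) * Real.Gamma ((d:ℝ)/2 - s + 1) /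
          Real.Gamma ((d:ℝ)/2 - s + 1 - α))
  have hY : 0 < Y := by positivity
  have h5 : -(((d:ℝ) - 1) / 2 * Real.pi ^ ((d:ℝ)/2) * ‖n‖^2 * Y / Real.Gamma s * J) -
      ((d:ℝ) - 1) / 2 * Real.pi ^ ((d:ℝ)/2) / Real.Gamma s *
        (1 / Real.Gamma ((d:ℝ)/2 + α + 1) * V) * (‖n‖^2 * Y * Z) =
      -(((d:ℝ) - 1) / 2 * Real.pi ^ ((d:ℝ)/2) / Real.Gamma s * ‖n‖^2 * Y) *
        (J - Z / Real.Gamma ((d:ℝ)/2 + α + 1) * -V) := by ring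
  rw [h5, abs_mul, abs_neg, abs_of_nonneg (by positivity)]
  calc _ ≤ ((d:ℝ) - 1) / 2 * Real.pi ^ ((d:ℝ)/2) / Real.Gamma s * ‖n‖^2 * Y * (ρ / ‖n‖^2) := by
        gcongr
    _ = _ := by field_simp
end
end

section
/- Let d ≥ 1 be an integer, α ∈ (0,1), and s ∈ (0, d/2 + α]. Then there exists a constant c = c(d,s,α) such that for all Schwartz functions v, w on ℝ^d, ‖v w‖_{H^{−s}} ≤ c ‖v‖_{H^{d/2+α}} ‖w‖_{H^{−s}}. -/
open MeasureTheory
open scoped RealInnerProductSpace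

noncomputable section

/-- The Fourier transform with convention `f̂(ξ) = (2π)^{−d/2} ∫ f(x) e^{−iξ·x} dx`. -/
def ftr (d : ℕ) (f : EuclideanSpace ℝ (Fin d) → ℂ) (ξ : EuclideanSpace ℝ (Fin d)) : ℂ :=
  ((2*Real.pi : ℝ) : ℂ) ^ ((-(d : ℝ)/2 : ℝ) : ℂ)
    * ∫ x : EuclideanSpace ℝ (Fin d), Complex.exp (-(Complex.I * ((⟪ξ, x⟫ : ℝ) : ℂ))) * f x

/-- The Sobolev norm `‖f‖_{H^σ} = (∫ ⟨ξ⟩^{2σ} |f̂(ξ)|² dξ)^{1/2}`. -/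
def sobNorm (d : ℕ) (σ : ℝ) (f : EuclideanSpace ℝ (Fin d) → ℂ) : ℝ :=
  Real.sqrt (∫ ξ : EuclideanSpace ℝ (Fin d), (1 + ‖ξ‖^2) ^ σ * ‖ftr d f ξ‖^2)

open FourierTransform in
theorem ftr_eq (d : ℕ) (f : EuclideanSpace ℝ (Fin d) → ℂ) (ξ : EuclideanSpace ℝ (Fin d)) :
    ftr d f ξ = ((2*Real.pi : ℝ) : ℂ) ^ ((-(d : ℝ)/2 : ℝ) : ℂ)
      * 𝓕 f ((2 * Real.pi)⁻¹ • ξ) := by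
  unfold ftr
  rw [Real.fourier_eq']
  congr 2
  ext x
  rw [smul_eq_mul]
  congr 2
  rw [real_inner_smul_right, real_inner_comm]
  have : Real.pi ≠ 0 := Real.pi_ne_zero
  push_cast
  have : (Real.pi : ℂ) ≠ 0 := by exact_mod_cast this
  field_simp

open FourierTransform in
theorem exists_schwartz_eq_ftr (d : ℕ) (f : SchwartzMap (EuclideanSpace ℝ (Fin d)) ℂ) :
    ∃ g : SchwartzMap (EuclideanSpace ℝ (Fin d)) ℂ, ∀ ξ, ftr d f ξ = g ξ := by
  have h : (2 * Real.pi)⁻¹ ≠ 0 := by have := Real.pi_pos; positivity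
  refine ⟨((2*Real.pi : ℝ) : ℂ) ^ ((-(d : ℝ)/2 : ℝ) : ℂ) •
    SchwartzMap.compCLMOfContinuousLinearEquiv ℂ
      (ContinuousLinearEquiv.smulLeft (R₁ := ℝ) (Units.mk0 _ h)) (𝓕 f), fun ξ => ?_⟩
  rw [ftr_eq]
  rfl

open FourierTransform in
theorem fourier_mul_eq_integral {E : Type*} [NormedAddCommGroup E] [InnerProductSpace ℝ E]
    [FiniteDimensional ℝ E] [MeasurableSpace E] [BorelSpace E]
    (v w : SchwartzMap E ℂ) (ξ : E) :
    𝓕 (fun x => v x * w x) ξ = ∫ τ, 𝓕 (v : E → ℂ) τ * 𝓕 (w : E → ℂ) (ξ - τ) := by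
  have key : (fun x => v x * w x) = 𝓕 (SchwartzMap.convolution
      (ContinuousLinearMap.mul ℂ ℂ) (𝓕⁻ v) (𝓕⁻ w)) := by
    rw [SchwartzMap.fourier_convolution]
    ext x
    simp
  have h2 : 𝓕 (fun x => v x * w x) ξ = SchwartzMap.convolution
      (ContinuousLinearMap.mul ℂ ℂ) (𝓕⁻ v) (𝓕⁻ w) (-ξ) := by
    rw [key, ← neg_neg ξ, ← Real.fourierInv_eq_fourier_neg, ← SchwartzMap.fourierInv_coe]
    simp
  rw [h2, SchwartzMap.convolution_apply, MeasureTheory.convolution_def]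
  rw [← integral_neg_eq_self]
  congr 1
  ext τ
  simp only [SchwartzMap.fourierInv_coe, Real.fourierInv_eq_fourier_neg, neg_neg,
    ContinuousLinearMap.mul_apply']
  rw [show -(-ξ - -τ) = ξ - τ by abel]

theorem enorm_ftr_mul_le (d : ℕ) : ∃ C : ℝ, 0 ≤ C ∧
    ∀ (v w : SchwartzMap (EuclideanSpace ℝ (Fin d)) ℂ) (ξ : EuclideanSpace ℝ (Fin d)),
      ‖ftr d (fun x => v x * w x) ξ‖ₑ
        ≤ ENNReal.ofReal C * ∫⁻ τ, ‖ftr d v τ‖ₑ * ‖ftr d w (ξ - τ)‖ₑ := by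
  set k : ℂ := ((2*Real.pi : ℝ) : ℂ) ^ ((-(d : ℝ)/2 : ℝ) : ℂ) with hk
  have hpi : (0:ℝ) < 2 * Real.pi := by have := Real.pi_pos; positivity
  have hk0 : k ≠ 0 := by
    rw [hk, Complex.cpow_ne_zero_iff]
    left; exact_mod_cast hpi.ne'
  set r : ℝ := |((2 * Real.pi)⁻¹ ^ d)| with hr
  refine ⟨‖k⁻¹ * r‖, norm_nonneg _, fun v w ξ => ?_⟩
  have h1 : ftr d (fun x => v x * w x) ξ
      = (k⁻¹ * r) * ∫ τ, ftr d v τ * ftr d w (ξ - τ) := by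
    have hsub := Measure.integral_comp_smul (volume : Measure (EuclideanSpace ℝ (Fin d)))
      (fun τ => ftr d v τ * ftr d w (ξ - τ)) (2 * Real.pi)
    rw [ftr_eq, fourier_mul_eq_integral, ← hk]
    simp only [finrank_euclideanSpace, Fintype.card_fin, ← inv_pow, ← hr] at hsub
    rw [mul_assoc, ← Complex.real_smul (x := r), ← hsub, ← integral_const_mul,
      ← integral_const_mul]
    congr 1
    ext τ
    rw [ftr_eq, ftr_eq, ← hk, smul_sub, inv_smul_smul₀ hpi.ne']
    field_simp
  rw [h1, enorm_mul, ofReal_norm]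
  gcongr
  refine (enorm_integral_le_lintegral_enorm _).trans_eq ?_
  simp only [enorm_mul]

theorem peetre_weight_le {a b D s σ : ℝ} (ha : 1 ≤ a) (hb : 1 ≤ b) (hD : 1 ≤ D)
    (h : D ≤ 2 * (a + b)) (hs : 0 ≤ s) (hσ : s ≤ σ) :
    a ^ (-s) * b ^ (-σ) ≤ 4 ^ s * ((a ^ (-σ) + b ^ (-σ)) * D ^ (-s)) := by
  have a0 : 0 < a := by linarith
  have b0 : 0 < b := by linarith
  have D0 : 0 < D := by linarith
  have pa := Real.rpow_pos_of_pos a0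
  have pb := Real.rpow_pos_of_pos b0
  have pD := Real.rpow_pos_of_pos D0
  suffices H : a ^ (-s) * b ^ (-σ) * D ^ s ≤ 4 ^ s * (a ^ (-σ) + b ^ (-σ)) by
    rw [Real.rpow_neg D0.le, ← mul_assoc, ← div_eq_mul_inv, le_div_iff₀ (pD s)]
    exact H
  rcases le_total b a with hab | hab
  · calc a ^ (-s) * b ^ (-σ) * D ^ s ≤ a ^ (-s) * b ^ (-σ) * (4 * a) ^ s := by
          gcongr; linarith
      _ = 4 ^ s * ((a ^ (-s) * a ^ s) * b ^ (-σ)) := by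
          rw [Real.mul_rpow (by norm_num) a0.le]; ring
      _ = 4 ^ s * b ^ (-σ) := by rw [← Real.rpow_add a0]; simp
      _ ≤ _ := by gcongr; linarith [pa (-σ)]
  · calc a ^ (-s) * b ^ (-σ) * D ^ s ≤ a ^ (-s) * b ^ (-σ) * (4 * b) ^ s := by
          gcongr; linarith
      _ = 4 ^ s * (a ^ (-s) * b ^ (-(σ - s))) := by
          rw [Real.mul_rpow (by norm_num) b0.le, show -(σ - s) = -σ + s by ring,
            Real.rpow_add b0]; ring
      _ ≤ 4 ^ s * (a ^ (-s) * a ^ (-(σ - s))) := by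
          gcongr 4 ^ s * (_ * ?_)
          exact Real.rpow_le_rpow_of_nonpos a0 hab (by linarith)
      _ = 4 ^ s * a ^ (-σ) := by rw [← Real.rpow_add a0]; ring_nf
      _ ≤ _ := by gcongr; linarith [pb (-σ)]

section Weights

variable {E : Type*} [NormedAddCommGroup E]

/-- The weight `⟨x⟩^{2σ}` as an extended nonnegative real. -/
def japaneseWeight (σ : ℝ) (x : E) : ENNReal := ENNReal.ofReal ((1 + ‖x‖ ^ 2) ^ σ)

theorem japaneseWeight_mul_le {s σ : ℝ} (hs : 0 ≤ s) (hσ : s ≤ σ) (ξ τ : E) :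
    japaneseWeight (-s) ξ * japaneseWeight (-σ) τ ≤ ENNReal.ofReal (4 ^ s) *
      ((japaneseWeight (-σ) ξ + japaneseWeight (-σ) τ) * japaneseWeight (-s) (ξ - τ)) := by
  unfold japaneseWeight
  rw [← ENNReal.ofReal_add (by positivity) (by positivity),
    ← ENNReal.ofReal_mul (by positivity), ← ENNReal.ofReal_mul (by positivity),
    ← ENNReal.ofReal_mul (by positivity)]
  apply ENNReal.ofReal_le_ofReal
  apply peetre_weight_le _ _ _ _ hs hσ
  · nlinarith [norm_nonneg ξ]
  · nlinarith [norm_nonneg τ]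
  · nlinarith [norm_nonneg (ξ - τ)]
  · have := norm_sub_le ξ τ
    nlinarith [norm_nonneg (ξ - τ), sq_nonneg (‖ξ‖ - ‖τ‖)]

variable [MeasurableSpace E] [BorelSpace E]

@[fun_prop]
theorem measurable_japaneseWeight (σ : ℝ) : Measurable (japaneseWeight σ : E → ENNReal) := by
  unfold japaneseWeight
  fun_prop

theorem sq_lintegral_mul_le (μ : Measure E) (σ : ℝ) {F G : E → ENNReal} (hF : Measurable F)
    (hG : Measurable G) :
    (∫⁻ τ, F τ * G τ ∂μ) ^ 2 ≤
      (∫⁻ τ, japaneseWeight σ τ * F τ ^ 2 ∂μ) * ∫⁻ τ, japaneseWeight (-σ) τ * G τ ^ 2 ∂μ := by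
  have hsq (σ : ℝ) (x : E) : japaneseWeight (σ / 2) x ^ 2 = japaneseWeight σ x := by
    unfold japaneseWeight
    rw [← ENNReal.ofReal_pow (by positivity), ← Real.rpow_mul_natCast (by positivity)]
    norm_num
  have hone (x : E) : japaneseWeight (σ / 2) x * japaneseWeight (-σ / 2) x = 1 := by
    unfold japaneseWeight
    rw [← ENNReal.ofReal_mul (by positivity), ← Real.rpow_add (by positivity)]
    simp [neg_div]
  have h := ENNReal.lintegral_mul_le_Lp_mul_Lq μ Real.HolderConjugate.two_two
    (f := fun x => japaneseWeight (σ / 2) x * F x)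
    (g := fun x => japaneseWeight (-σ / 2) x * G x) (by fun_prop) (by fun_prop)
  have h1 : ∀ x, ((fun x => japaneseWeight (σ / 2) x * F x) *
      fun x => japaneseWeight (-σ / 2) x * G x) x = F x * G x := fun x => by
    simp only [Pi.mul_apply]
    rw [mul_mul_mul_comm, hone, one_mul]
  simp only [h1, ENNReal.rpow_two, mul_pow, hsq] at h
  refine (pow_le_pow_left' h 2).trans_eq ?_
  rw [mul_pow, ← ENNReal.rpow_mul_natCast, ← ENNReal.rpow_mul_natCast]
  norm_num

theorem lintegral_weight_mul_sq_conv_le [SecondCountableTopology E] (μ : Measure E) [SFinite μ]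
    [μ.IsAddLeftInvariant] [μ.IsNegInvariant] {s σ : ℝ} (hs : 0 ≤ s) (hσ : s ≤ σ)
    {F G : E → ENNReal} (hF : Measurable F) (hG : Measurable G) :
    ∫⁻ ξ, japaneseWeight (-s) ξ * (∫⁻ τ, F τ * G (ξ - τ) ∂μ) ^ 2 ∂μ ≤
      ENNReal.ofReal (4 ^ s) * (2 * ∫⁻ ξ, japaneseWeight (-σ) ξ ∂μ) *
        (∫⁻ ξ, japaneseWeight σ ξ * F ξ ^ 2 ∂μ) *
        ∫⁻ ξ, japaneseWeight (-s) ξ * G ξ ^ 2 ∂μ := by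
  set A := ∫⁻ ξ, japaneseWeight σ ξ * F ξ ^ 2 ∂μ
  set c := ENNReal.ofReal (4 ^ s)
  set g : E → ENNReal := fun x => japaneseWeight (-s) x * G x ^ 2 with hg
  have hgm : Measurable g := by fun_prop
  have hpt (ξ : E) : japaneseWeight (-s) ξ * (∫⁻ τ, F τ * G (ξ - τ) ∂μ) ^ 2 ≤
      A * c * ∫⁻ τ, (japaneseWeight (-σ) ξ * g (ξ - τ) + japaneseWeight (-σ) τ * g (ξ - τ)) ∂μ := by
    calc _ ≤ japaneseWeight (-s) ξ *
          (A * ∫⁻ τ, japaneseWeight (-σ) τ * G (ξ - τ) ^ 2 ∂μ) := by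
          gcongr
          exact sq_lintegral_mul_le μ σ hF (by fun_prop)
      _ = A * ∫⁻ τ, japaneseWeight (-s) ξ * (japaneseWeight (-σ) τ * G (ξ - τ) ^ 2) ∂μ := by
          rw [lintegral_const_mul _ (by fun_prop)]; ring
      _ ≤ A * ∫⁻ τ, c * (japaneseWeight (-σ) ξ * g (ξ - τ)
            + japaneseWeight (-σ) τ * g (ξ - τ)) ∂μ := by
          refine mul_le_mul_right (lintegral_mono fun τ => ?_) A
          calc _ = (japaneseWeight (-s) ξ * japaneseWeight (-σ) τ) * G (ξ - τ) ^ 2 := by ring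
            _ ≤ (c * ((japaneseWeight (-σ) ξ + japaneseWeight (-σ) τ)
                * japaneseWeight (-s) (ξ - τ))) * G (ξ - τ) ^ 2 := by
                gcongr ?_ * _
                exact japaneseWeight_mul_le hs hσ ξ τ
            _ = _ := by simp only [hg]; ring
      _ = _ := by rw [lintegral_const_mul _ (by fun_prop), mul_assoc]
  refine (lintegral_mono hpt).trans_eq ?_
  rw [lintegral_const_mul _ (by fun_prop)]
  have h1 : ∫⁻ ξ, ∫⁻ τ, (japaneseWeight (-σ) ξ * g (ξ - τ)
      + japaneseWeight (-σ) τ * g (ξ - τ)) ∂μ ∂μ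
      = 2 * (∫⁻ ξ, japaneseWeight (-σ) ξ ∂μ) * ∫⁻ ξ, g ξ ∂μ := by
    have e1 (ξ : E) : ∫⁻ τ, (japaneseWeight (-σ) ξ * g (ξ - τ)
        + japaneseWeight (-σ) τ * g (ξ - τ)) ∂μ = japaneseWeight (-σ) ξ * (∫⁻ τ, g τ ∂μ)
        + ∫⁻ τ, japaneseWeight (-σ) τ * g (ξ - τ) ∂μ := by
      rw [lintegral_add_left (by fun_prop), lintegral_const_mul _ (by fun_prop),
        lintegral_sub_left_eq_self g ξ]
    simp only [e1]
    rw [lintegral_add_left (by fun_prop), lintegral_mul_const _ (by fun_prop),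
      lintegral_lintegral_swap (by fun_prop)]
    have e2 (τ : E) : ∫⁻ ξ, japaneseWeight (-σ) τ * g (ξ - τ) ∂μ
        = japaneseWeight (-σ) τ * ∫⁻ ξ, g ξ ∂μ := by
      rw [lintegral_const_mul _ (by fun_prop), lintegral_sub_right_eq_self g τ]
    simp only [e2]
    rw [lintegral_mul_const _ (by fun_prop)]
    ring
  rw [h1]
  ring

end Weights

theorem integrable_weight_mul_schwartz_sq {E : Type*} [NormedAddCommGroup E]
    [NormedSpace ℝ E] [FiniteDimensional ℝ E] [MeasurableSpace E] [BorelSpace E]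
    (μ : Measure E) [μ.HasTemperateGrowth] (σ : ℝ) (g : SchwartzMap E ℂ) :
    Integrable (fun ξ => (1 + ‖ξ‖ ^ 2) ^ σ * ‖g ξ‖ ^ 2) μ := by
  obtain ⟨n, hn⟩ := exists_nat_ge σ
  have hint : Integrable (fun ξ => (SchwartzMap.seminorm ℝ 0 0 g) *
      (2 ^ n * (‖ξ‖ ^ 0 * ‖g ξ‖ + ‖ξ‖ ^ (2 * n) * ‖g ξ‖))) μ :=
    (((g.integrable_pow_mul μ 0).add (g.integrable_pow_mul μ (2 * n))).const_mul _).const_mul _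
  refine hint.mono' ?_ (Filter.Eventually.of_forall fun ξ => ?_)
  · have := g.continuous
    apply Measurable.aestronglyMeasurable
    have := this.measurable
    fun_prop
  · rw [Real.norm_of_nonneg (by positivity)]
    have h1 : (1 + ‖ξ‖ ^ 2) ^ σ ≤ 2 ^ n * (1 + ‖ξ‖ ^ (2 * n)) := by
      have hone : (1:ℝ) ≤ 1 + ‖ξ‖ ^ 2 := by nlinarith [norm_nonneg ξ]
      calc (1 + ‖ξ‖ ^ 2) ^ σ ≤ (1 + ‖ξ‖ ^ 2) ^ (n : ℝ) :=
            Real.rpow_le_rpow_of_exponent_le hone hn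
        _ = (1 + ‖ξ‖ ^ 2) ^ n := Real.rpow_natCast _ _
        _ ≤ 2 ^ (n - 1) * (1 ^ n + (‖ξ‖ ^ 2) ^ n) := add_pow_le (by norm_num) (by positivity) n
        _ ≤ 2 ^ n * (1 + ‖ξ‖ ^ (2 * n)) := by
            rw [one_pow, ← pow_mul]
            gcongr
            · norm_num
            · omega
    have h2 := SchwartzMap.norm_le_seminorm ℝ g ξ
    calc _ ≤ (2 ^ n * (1 + ‖ξ‖ ^ (2 * n))) * (SchwartzMap.seminorm ℝ 0 0 g * ‖g ξ‖) := by
          rw [sq ‖g ξ‖]; gcongr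
      _ = _ := by ring

theorem sobNorm_nonneg (d : ℕ) (σ : ℝ) (f : EuclideanSpace ℝ (Fin d) → ℂ) :
    0 ≤ sobNorm d σ f := Real.sqrt_nonneg _

theorem ofReal_weight_mul_sq {E : Type*} [NormedAddCommGroup E] (σ : ℝ) (ξ : E) (z : ℂ) :
    ENNReal.ofReal ((1 + ‖ξ‖ ^ 2) ^ σ * ‖z‖ ^ 2) = japaneseWeight σ ξ * ‖z‖ₑ ^ 2 := by
  rw [ENNReal.ofReal_mul (by positivity), ENNReal.ofReal_pow (norm_nonneg _), ofReal_norm]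
  rfl

theorem ofReal_sobNorm_sq (d : ℕ) (σ : ℝ) (f : SchwartzMap (EuclideanSpace ℝ (Fin d)) ℂ) :
    ENNReal.ofReal (sobNorm d σ f ^ 2) = ∫⁻ ξ, japaneseWeight σ ξ * ‖ftr d f ξ‖ₑ ^ 2 := by
  obtain ⟨g, hg⟩ := exists_schwartz_eq_ftr d f
  unfold sobNorm
  rw [Real.sq_sqrt (integral_nonneg fun ξ => by positivity)]
  simp only [hg]
  rw [ofReal_integral_eq_lintegral_ofReal (integrable_weight_mul_schwartz_sq _ σ g)
    (Filter.Eventually.of_forall fun ξ => by positivity)]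
  simp only [ofReal_weight_mul_sq]

/-- Product estimate: for `d ≥ 1`, `α ∈ (0,1)`, `s ∈ (0, d/2+α]`, there is a
constant `c` such that `‖vw‖_{H^{−s}} ≤ c ‖v‖_{H^{d/2+α}} ‖w‖_{H^{−s}}` for all Schwartz
functions `v, w` on `ℝ^d`. -/
theorem stmt9 (d : ℕ) (hd : 1 ≤ d) (α : ℝ) (hα0 : 0 < α) (hα1 : α < 1)
    (s : ℝ) (hs0 : 0 < s) (hs1 : s ≤ (d : ℝ)/2 + α) :
    ∃ c : ℝ, 0 ≤ c ∧ ∀ v w : SchwartzMap (EuclideanSpace ℝ (Fin d)) ℂ,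
      sobNorm d (-s) (fun x => v x * w x)
        ≤ c * sobNorm d ((d : ℝ)/2 + α) v * sobNorm d (-s) w := by
  obtain ⟨C, hC, hconv⟩ := enorm_ftr_mul_le d
  set σ : ℝ := (d : ℝ) / 2 + α with hσ
  have hJ : Integrable (fun ξ : EuclideanSpace ℝ (Fin d) => (1 + ‖ξ‖ ^ 2) ^ (-σ)) := by
    have := integrable_rpow_neg_one_add_norm_sq (E := EuclideanSpace ℝ (Fin d))
      (μ := volume) (r := 2 * σ) (by simp [hσ]; linarith)
    convert this using 3
    ring
  set J : ℝ := ∫ ξ : EuclideanSpace ℝ (Fin d), (1 + ‖ξ‖ ^ 2) ^ (-σ)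
  have hJ0 : 0 ≤ J := integral_nonneg fun ξ => by positivity
  have hJe : ∫⁻ ξ : EuclideanSpace ℝ (Fin d), japaneseWeight (-σ) ξ = ENNReal.ofReal J :=
    (ofReal_integral_eq_lintegral_ofReal hJ
      (Filter.Eventually.of_forall fun ξ => by positivity)).symm
  refine ⟨Real.sqrt (C ^ 2 * (4 ^ s * (2 * J))), Real.sqrt_nonneg _, fun v w => ?_⟩
  have hm (f : SchwartzMap (EuclideanSpace ℝ (Fin d)) ℂ) :
      Measurable fun ξ => ‖ftr d f ξ‖ₑ := by
    obtain ⟨g, hg⟩ := exists_schwartz_eq_ftr d f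
    simp only [hg]
    exact g.continuous.measurable.enorm
  have hvw := ofReal_sobNorm_sq d (-s)
    (SchwartzMap.pairing (ContinuousLinearMap.mul ℂ ℂ) v w)
  have hcoe : (SchwartzMap.pairing (ContinuousLinearMap.mul ℂ ℂ) v w :
      EuclideanSpace ℝ (Fin d) → ℂ) = fun x => v x * w x := by
    ext x; simp
  rw [hcoe] at hvw
  have hmain : ENNReal.ofReal (sobNorm d (-s) (fun x => v x * w x) ^ 2) ≤
      ENNReal.ofReal (C ^ 2 * (4 ^ s * (2 * J)) * sobNorm d σ v ^ 2 * sobNorm d (-s) w ^ 2) := by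
    rw [hvw]
    calc _ ≤ ∫⁻ ξ, ENNReal.ofReal C ^ 2 * (japaneseWeight (-s) ξ *
          (∫⁻ τ, ‖ftr d v τ‖ₑ * ‖ftr d w (ξ - τ)‖ₑ) ^ 2) := by
          refine lintegral_mono fun ξ => ?_
          rw [mul_left_comm, ← mul_pow]
          gcongr
          exact hconv v w ξ
      _ = ENNReal.ofReal C ^ 2 * ∫⁻ ξ, (japaneseWeight (-s) ξ *
          (∫⁻ τ, ‖ftr d v τ‖ₑ * ‖ftr d w (ξ - τ)‖ₑ) ^ 2) :=
          lintegral_const_mul' _ _ (by simp)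
      _ ≤ ENNReal.ofReal C ^ 2 * (ENNReal.ofReal (4 ^ s) *
          (2 * ∫⁻ ξ : EuclideanSpace ℝ (Fin d), japaneseWeight (-σ) ξ) *
          (∫⁻ ξ, japaneseWeight σ ξ * ‖ftr d v ξ‖ₑ ^ 2) *
          ∫⁻ ξ, japaneseWeight (-s) ξ * ‖ftr d w ξ‖ₑ ^ 2) := by
          gcongr
          exact lintegral_weight_mul_sq_conv_le volume hs0.le hs1 (hm v) (hm w)
      _ = _ := by
          rw [hJe, ← ofReal_sobNorm_sq, ← ofReal_sobNorm_sq, ENNReal.ofReal_mul (by positivity),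
            ENNReal.ofReal_mul (by positivity), ENNReal.ofReal_mul (by positivity),
            ENNReal.ofReal_mul (by positivity), ENNReal.ofReal_mul (by norm_num),
            ENNReal.ofReal_pow hC, ENNReal.ofReal_ofNat]
          ring
  have hnn : 0 ≤ C ^ 2 * (4 ^ s * (2 * J)) * sobNorm d σ v ^ 2 * sobNorm d (-s) w ^ 2 := by
    positivity
  have hreal := (ENNReal.ofReal_le_ofReal_iff hnn).1 hmain
  have hv := sobNorm_nonneg d σ v
  have hw := sobNorm_nonneg d (-s) w
  refine le_of_sq_le_sq ?_ (by positivity)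
  rw [mul_pow, mul_pow, Real.sq_sqrt (by positivity)]
  exact hreal
end
end

section
/- Let d ≥ 1 be an integer, α > 0 and σ ∈ (0, d/2). Then there exists a constant C = C(d,σ,α) such that for every n ∈ ℝ^d, ∫_{ℝ^d} ⟨n−k⟩^{−d−2α} |k|^{−2σ} dk ≤ C ⟨n⟩^{−2σ}. -/
open MeasureTheory

noncomputable section

lemma one_le_jap {d : ℕ} (x : EuclideanSpace ℝ (Fin d)) : 1 ≤ jap x :=
  Real.one_le_sqrt.2 (by nlinarith [sq_nonneg ‖x‖])

lemma jap_pos {d : ℕ} (x : EuclideanSpace ℝ (Fin d)) : 0 < jap x :=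
  one_pos.trans_le (one_le_jap x)

lemma jap_le_jap_sub_add_norm {d : ℕ} (x y : EuclideanSpace ℝ (Fin d)) :
    jap x ≤ jap (x - y) + ‖y‖ := by
  have hsq : jap (x - y) ^ 2 = 1 + ‖x - y‖ ^ 2 := Real.sq_sqrt (by positivity)
  have hle : ‖x - y‖ ≤ jap (x - y) := Real.le_sqrt_of_sq_le (by linarith)
  have htri : ‖x‖ ≤ ‖x - y‖ + ‖y‖ := by simpa using norm_add_le (x - y) y
  refine Real.sqrt_le_iff.2 ⟨add_nonneg (jap_pos _).le (norm_nonneg y), ?_⟩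
  nlinarith [mul_le_mul_of_nonneg_right hle (norm_nonneg y),
    pow_le_pow_left₀ (norm_nonneg x) htri 2]

lemma integrable_jap_rpow_neg {d : ℕ} {p : ℝ} (hp : (d : ℝ) < p) :
    Integrable (fun x : EuclideanSpace ℝ (Fin d) => jap x ^ (-p)) := by
  have h := integrable_rpow_neg_one_add_norm_sq
    (μ := (volume : Measure (EuclideanSpace ℝ (Fin d)))) (r := p) (by simpa using hp)
  refine h.congr (Filter.Eventually.of_forall fun x => ?_)
  simp only [jap, Real.sqrt_eq_rpow]
  rw [← Real.rpow_mul (by positivity)]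
  ring_nf

lemma integrableOn_ball_norm_rpow_neg {d : ℕ} (hd : 1 ≤ d) {s : ℝ} (hs : s < d) {r : ℝ}
    (hr : 0 < r) :
    IntegrableOn (fun x : EuclideanSpace ℝ (Fin d) => ‖x‖ ^ (-s)) (Metric.ball 0 r) := by
  have : Nonempty (Fin d) := ⟨⟨0, hd⟩⟩
  rw [integrableOn_fun_norm_addHaar volume (f := fun y : ℝ => y ^ (-s))]
  have h : IntegrableOn (fun y : ℝ => y ^ ((d : ℝ) - 1 - s)) (Set.Ioo 0 r) :=
    (intervalIntegral.integrableOn_Ioo_rpow_iff hr).2 (by linarith)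
  refine h.congr_fun (fun y hy => ?_) measurableSet_Ioo
  simp only [finrank_euclideanSpace, Fintype.card_fin, smul_eq_mul]
  rw [← Real.rpow_natCast, ← Real.rpow_add hy.1, Nat.cast_sub hd, Nat.cast_one, sub_eq_add_neg]

lemma jap_sub_rpow_mul_norm_rpow_le {d : ℕ} {p s : ℝ} (hp : 0 < p) (hs : 0 < s)
    (n k : EuclideanSpace ℝ (Fin d)) :
    jap (n - k) ^ (-p) * ‖k‖ ^ (-s) ≤
      2 ^ p * jap n ^ (-p) * jap n ^ (-s) *
          (Metric.ball (0 : EuclideanSpace ℝ (Fin d)) (1 / 2)).indicator (fun x => ‖x‖ ^ (-s))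
            ((jap n)⁻¹ • k) +
        2 ^ s * jap n ^ (-s) * jap (n - k) ^ (-p) := by
  have hn := jap_pos n
  have hnk := jap_pos (n - k)
  have hhalf (q : ℝ) : (jap n / 2) ^ (-q) = 2 ^ q * jap n ^ (-q) := by
    rw [Real.div_rpow hn.le zero_le_two, Real.rpow_neg zero_le_two, div_inv_eq_mul, mul_comm]
  have hnorm : ‖(jap n)⁻¹ • k‖ = (jap n)⁻¹ * ‖k‖ := by
    rw [norm_smul, Real.norm_of_nonneg (inv_nonneg.2 hn.le)]
  rcases lt_or_ge ‖k‖ (jap n / 2) with hk | hk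
  · have hmem : (jap n)⁻¹ • k ∈ Metric.ball (0 : EuclideanSpace ℝ (Fin d)) (1 / 2) := by
      rw [mem_ball_zero_iff, hnorm, inv_mul_lt_iff₀ hn]
      linarith
    have hscale : jap n ^ (-s) * ((jap n)⁻¹ * ‖k‖) ^ (-s) = ‖k‖ ^ (-s) := by
      rw [← Real.mul_rpow hn.le (by positivity), mul_inv_cancel_left₀ hn.ne']
    have hle : jap (n - k) ^ (-p) ≤ 2 ^ p * jap n ^ (-p) := by
      rw [← hhalf]
      exact Real.rpow_le_rpow_of_nonpos (by positivity)
        (by linarith [jap_le_jap_sub_add_norm n k]) (by linarith)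
    rw [Set.indicator_of_mem hmem, hnorm, mul_assoc _ (jap n ^ (-s)), hscale]
    exact (mul_le_mul_of_nonneg_right hle (by positivity)).trans
      (le_add_of_nonneg_right (by positivity))
  · have hle : ‖k‖ ^ (-s) ≤ 2 ^ s * jap n ^ (-s) := by
      rw [← hhalf]
      exact Real.rpow_le_rpow_of_nonpos (by positivity) hk (by linarith)
    rw [mul_comm]
    refine (mul_le_mul_of_nonneg_right hle (by positivity)).trans (le_add_of_nonneg_left ?_)
    exact mul_nonneg (by positivity) (Set.indicator_nonneg (fun x _ => by positivity) _)

/-- For `d ≥ 1`, `α > 0` and `σ ∈ (0, d/2)`, there is a constant `C` such that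
`∫_{ℝ^d} ⟨n−k⟩^{−d−2α} |k|^{−2σ} dk ≤ C ⟨n⟩^{−2σ}` for every `n ∈ ℝ^d`. -/
theorem stmt11 (d : ℕ) (hd : 1 ≤ d) (α σ : ℝ) (hα : 0 < α) (hσ : 0 < σ)
    (hσd : σ < (d : ℝ)/2) :
    ∃ C : ℝ, ∀ n : EuclideanSpace ℝ (Fin d),
      (∫ k : EuclideanSpace ℝ (Fin d), jap (n - k) ^ (-(d : ℝ) - 2*α) * ‖k‖ ^ (-(2*σ)))
        ≤ C * jap n ^ (-(2*σ)) := by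
  obtain ⟨p, hp⟩ : ∃ p : ℝ, p = d + 2 * α := ⟨_, rfl⟩
  obtain ⟨s, hs⟩ : ∃ s : ℝ, s = 2 * σ := ⟨_, rfl⟩
  rw [show -(d : ℝ) - 2 * α = -p by rw [hp]; ring, ← hs]
  have hdp : (d : ℝ) < p := by linarith
  have hp0 : 0 < p := (Nat.cast_nonneg d).trans_lt hdp
  have hs0 : 0 < s := by linarith
  set g := (Metric.ball (0 : EuclideanSpace ℝ (Fin d)) (1 / 2)).indicator
    (fun x => ‖x‖ ^ (-s))
  have hgint : Integrable g :=
    (integrableOn_ball_norm_rpow_neg hd (by linarith) one_half_pos).integrable_indicator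
      measurableSet_ball
  have hg0 : 0 ≤ ∫ x, g x :=
    integral_nonneg (Set.indicator_nonneg (fun x _ => by positivity))
  have hjint := integrable_jap_rpow_neg hdp
  refine ⟨2 ^ p * (∫ x, g x) +
    2 ^ s * ∫ x : EuclideanSpace ℝ (Fin d), jap x ^ (-p), fun n => ?_⟩
  have hn := jap_pos n
  have hint₁ : Integrable fun k => 2 ^ p * jap n ^ (-p) * jap n ^ (-s) * g ((jap n)⁻¹ • k) :=
    (hgint.comp_smul (inv_ne_zero hn.ne')).const_mul _
  have hint₂ : Integrable fun k => 2 ^ s * jap n ^ (-s) * jap (n - k) ^ (-p) :=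
    (hjint.comp_sub_left n).const_mul _
  have hdecay : jap n ^ (-p) * jap n ^ d ≤ 1 := by
    rw [← Real.rpow_natCast, ← Real.rpow_add hn]
    exact Real.rpow_le_one_of_one_le_of_nonpos (one_le_jap n) (by linarith)
  calc
    _ ≤ ∫ k, (2 ^ p * jap n ^ (-p) * jap n ^ (-s) * g ((jap n)⁻¹ • k) +
          2 ^ s * jap n ^ (-s) * jap (n - k) ^ (-p)) :=
      integral_mono_of_nonneg
        (.of_forall fun k => mul_nonneg (Real.rpow_nonneg (jap_pos _).le _) (by positivity))
        (hint₁.add hint₂)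
        (.of_forall fun k => jap_sub_rpow_mul_norm_rpow_le hp0 hs0 n k)
    _ = (jap n ^ (-p) * jap n ^ d) * (2 ^ p * (∫ x, g x) * jap n ^ (-s)) +
          2 ^ s * jap n ^ (-s) * ∫ x : EuclideanSpace ℝ (Fin d), jap x ^ (-p) := by
      rw [integral_add hint₁ hint₂, integral_const_mul, integral_const_mul,
        integral_sub_left_eq_self (fun x => jap x ^ (-p)), Measure.integral_comp_inv_smul,
        finrank_euclideanSpace, Fintype.card_fin, abs_of_pos (pow_pos hn d), smul_eq_mul]
      ring
    _ ≤ 1 * (2 ^ p * (∫ x, g x) * jap n ^ (-s)) +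
          2 ^ s * jap n ^ (-s) * ∫ x : EuclideanSpace ℝ (Fin d), jap x ^ (-p) := by
      gcongr
    _ = _ := by ring
end
end
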